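/- Let r = s + v with s ∈ ℕ₀ and 0 < v ≤ 1, c₀ > 0 and d′ ≤ d. There exist constants c₆, c₇, c₈ > 0 depending only on c₀, r, d and f*, and a constant γ > 0, such that for every n ∈ ℕ and every partially radial function f* ∈ Lip^{(r,c₀)} of the form f*(x) = g(t_{d′}, x^{(d′+1)}, …, x^{(d)}) with t_{d′} = (d′)^{−1/2}((x^{(1)})² + ⋯ + (x^{(d′)})²) and g ∈ Lip^{(r,c₀)} on [−1,1]^{d−d′+1}, there exists a deep ReLU net h_{f*} with 4(d−d′+1+r)(d−d′+3+s)/((d−d′+1)τ_r) + 8(d−d′+1+s) + 20 hidden layers and at most c₆ n free parameters, each bounded in absolute value by c₇ n^{max{1, (r+d−d′+1)γ, γr/τ_r}/(d−d′+1)}, such that sup_{x ∈ [−1,1]^d} |f*(x) − h_{f*}(x)| ≤ c₈ n^{−r/(d−d′+1)}. -/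

import Mathlib

open scoped Classical BigOperators

noncomputable section

/-- The ReLU activation. -/
def relu (t : ℝ) : ℝ := max t 0

/-- The cube `[-1,1]^d`. -/
def cube (d : ℕ) : Set (Fin d → ℝ) := {x | ∀ i, |x i| ≤ 1}

/-- The Euclidean norm on `Fin d → ℝ`. -/
def enorm2 {d : ℕ} (x : Fin d → ℝ) : ℝ := Real.sqrt (∑ i, (x i) ^ 2)

/-- A deep ReLU net with `L` hidden layers on input dimension `d`:
`h₀(x) = x`, `h_{k+1}(x) = σ(W_k h_k(x) + b_k)` componentwise with `σ = relu`,
and output `a ⬝ h_L(x)`. -/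
structure ReLUNet (d : ℕ) where
  L : ℕ
  width : ℕ → ℕ
  width_zero : width 0 = d
  W : (k : ℕ) → Matrix (Fin (width (k + 1))) (Fin (width k)) ℝ
  b : (k : ℕ) → Fin (width (k + 1)) → ℝ
  a : Fin (width L) → ℝ

namespace ReLUNet

variable {d : ℕ}

/-- The vector of hidden-layer values. -/
def hidden (net : ReLUNet d) (x : Fin d → ℝ) : (k : ℕ) → Fin (net.width k) → ℝ
  | 0, i => x (Fin.cast net.width_zero i)
  | k + 1, i => relu ((∑ j, net.W k i j * hidden net x k j) + net.b k i)

/-- The output of the network. -/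
def eval (net : ReLUNet d) (x : Fin d → ℝ) : ℝ :=
  ∑ i, net.a i * net.hidden x net.L i

/-- The number of free (nonzero) parameters of the network: the nonzero entries of
the matrices `W_k` and of the vectors `b_k` (for `k < L`) and of `a`. -/
def numParams (net : ReLUNet d) : ℕ :=
  (∑ k ∈ Finset.range net.L,
      ((Finset.univ.filter fun p : Fin (net.width (k + 1)) × Fin (net.width k) =>
          net.W k p.1 p.2 ≠ 0).card
        + (Finset.univ.filter fun i : Fin (net.width (k + 1)) => net.b k i ≠ 0).card))
    + (Finset.univ.filter fun i : Fin (net.width net.L) => net.a i ≠ 0).card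

/-- All weights, thresholds and outer coefficients are bounded by `R` in absolute value. -/
def paramBound (net : ReLUNet d) (R : ℝ) : Prop :=
  (∀ k < net.L, ∀ i j, |net.W k i j| ≤ R) ∧
    (∀ k < net.L, ∀ i, |net.b k i| ≤ R) ∧
    ∀ i, |net.a i| ≤ R

end ReLUNet

/-- `f` is `(r, c₀)`-smooth on `[-1,1]^d` with `r = s + v`, `0 < v ≤ 1`:
`f` is `s` times differentiable there and every order-`s` partial derivative
(realized by applying the `s`-th derivative to coordinate directions) satisfies the
Hölder/Lipschitz condition of exponent `v` with constant `c₀` in the Euclidean norm. -/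
def LipSmooth (d s : ℕ) (v c₀ : ℝ) (f : (Fin d → ℝ) → ℝ) : Prop :=
  ContDiffOn ℝ s f (cube d) ∧
    ∀ k : Fin s → Fin d, ∀ x ∈ cube d, ∀ x' ∈ cube d,
      |iteratedFDerivWithin ℝ s f (cube d) x (fun j => Pi.single (k j) 1) -
          iteratedFDerivWithin ℝ s f (cube d) x' (fun j => Pi.single (k j) 1)| ≤
        c₀ * (enorm2 (x - x')) ^ v

/-- `τ_r` for `r = s + v`: equal to `1` if `r ≥ 1` and to `v` if `r < 1`. -/
def tauR (s : ℕ) (v : ℝ) : ℝ := if 1 ≤ (s : ℝ) + v then 1 else v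

/-- Extend `x : Fin d → ℝ` by zero to all of `ℕ`. -/
def extendZ {d : ℕ} (x : Fin d → ℝ) : ℕ → ℝ := fun m => if h : m < d then x ⟨m, h⟩ else 0

/-! ### Hidden layers indexed by arbitrary finite types -/

/-- The number of nonzero entries of a weight matrix and a threshold vector. -/
def layerCost {κ ι : Type} [Fintype κ] [Fintype ι] (W : κ → ι → ℝ) (b : κ → ℝ) : ℕ :=
  ∑ i, ((∑ j, if W i j = 0 then 0 else 1) + if b i = 0 then 0 else 1)

theorem layerCost_comp_equiv {κ ι κ' ι' : Type} [Fintype κ] [Fintype ι] [Fintype κ'] [Fintype ι']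
    (e : κ' ≃ κ) (f : ι' ≃ ι) (W : κ → ι → ℝ) (b : κ → ℝ) :
    layerCost (fun i j => W (e i) (f j)) (fun i => b (e i)) = layerCost W b := by
  unfold layerCost
  rw [← Equiv.sum_comp e]
  refine Finset.sum_congr rfl fun i _ => ?_
  rw [← Equiv.sum_comp f]

/-- `HidRep d R L κ P H` says that `H` is the vector of values of hidden layer `L + 1` of a
ReLU net whose parameters up to that layer are bounded by `R`, at most `P` of them nonzero. -/
def HidRep (d : ℕ) (R : ℝ) :
    ℕ → (κ : Type) → [Fintype κ] → ℕ → ((Fin d → ℝ) → κ → ℝ) → Prop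
  | 0, κ, _, P, H => ∃ (W : κ → Fin d → ℝ) (b : κ → ℝ),
      (∀ i j, |W i j| ≤ R) ∧ (∀ i, |b i| ≤ R) ∧ layerCost W b ≤ P ∧
        ∀ x i, H x i = relu ((∑ j, W i j * x j) + b i)
  | L + 1, κ, _, P, H => ∃ (ι : Type) (_ : Fintype ι) (P' : ℕ) (H' : (Fin d → ℝ) → ι → ℝ)
      (W : κ → ι → ℝ) (b : κ → ℝ), HidRep d R L ι P' H' ∧
      (∀ i j, |W i j| ≤ R) ∧ (∀ i, |b i| ≤ R) ∧ P' + layerCost W b ≤ P ∧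
        ∀ x i, H x i = relu ((∑ j, W i j * H' x j) + b i)

namespace HidRep

variable {d : ℕ} {R : ℝ} {L P : ℕ}

theorem mono {R' : ℝ} (hR : R ≤ R') {κ : Type} [Fintype κ] {P' : ℕ} (hP : P ≤ P')
    {H : (Fin d → ℝ) → κ → ℝ} (h : HidRep d R L κ P H) : HidRep d R' L κ P' H := by
  induction L generalizing κ P P' with
  | zero =>
    obtain ⟨W, b, hW, hb, hc, hH⟩ := h
    exact ⟨W, b, fun i j => (hW i j).trans hR, fun i => (hb i).trans hR, hc.trans hP, hH⟩
  | succ L ih =>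
    obtain ⟨ι, _, P₀, H', W, b, h', hW, hb, hc, hH⟩ := h
    exact ⟨ι, _, P₀, H', W, b, ih le_rfl h', fun i j => (hW i j).trans hR,
      fun i => (hb i).trans hR, hc.trans hP, hH⟩

theorem reindex {κ κ' : Type} [Fintype κ] [Fintype κ'] (e : κ' ≃ κ)
    {H : (Fin d → ℝ) → κ → ℝ} (h : HidRep d R L κ P H) :
    HidRep d R L κ' P (fun x i => H x (e i)) := by
  cases L with
  | zero =>
    obtain ⟨W, b, hW, hb, hc, hH⟩ := h
    exact ⟨fun i j => W (e i) j, fun i => b (e i), fun i j => hW _ _, fun i => hb _,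
      (layerCost_comp_equiv e (Equiv.refl _) W b).trans_le hc, fun x i => hH x _⟩
  | succ L =>
    obtain ⟨ι, _, P₀, H', W, b, h', hW, hb, hc, hH⟩ := h
    refine ⟨ι, _, P₀, H', fun i j => W (e i) j, fun i => b (e i), h', fun i j => hW _ _,
      fun i => hb _, ?_, fun x i => hH x _⟩
    rw [show layerCost (fun i j => W (e i) j) (fun i => b (e i)) = layerCost W b from
      layerCost_comp_equiv e (Equiv.refl _) W b]
    exact hc

/-- The block-diagonal matrix with blocks `W i`. -/
def blockDiag {ι : Type} {κ κ' : ι → Type} (W : ∀ i, κ i → κ' i → ℝ)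
    (p : Σ i, κ i) (q : Σ i, κ' i) : ℝ :=
  if h : q.1 = p.1 then W p.1 p.2 (h ▸ q.2) else 0

theorem abs_blockDiag_le (hR : 0 ≤ R) {ι : Type} {κ κ' : ι → Type} (W : ∀ i, κ i → κ' i → ℝ)
    (hW : ∀ i k l, |W i k l| ≤ R) (p : Σ i, κ i) (q : Σ i, κ' i) : |blockDiag W p q| ≤ R := by
  unfold blockDiag
  split_ifs with h
  · exact hW _ _ _
  · simpa using hR

theorem sum_blockDiag_mul {ι : Type} [Fintype ι] {κ κ' : ι → Type} [∀ i, Fintype (κ' i)]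
    (W : ∀ i, κ i → κ' i → ℝ) (p : Σ i, κ i) (y : ∀ i, κ' i → ℝ) :
    ∑ q : (Σ i, κ' i), blockDiag W p q * y q.1 q.2 = ∑ l, W p.1 p.2 l * y p.1 l := by
  rw [Fintype.sum_sigma, Finset.sum_eq_single p.1]
  · simp [blockDiag]
  · intro i _ hi
    simp [blockDiag, hi]
  · simp

theorem layerCost_blockDiag {ι : Type} [Fintype ι] {κ κ' : ι → Type} [∀ i, Fintype (κ i)]
    [∀ i, Fintype (κ' i)] (W : ∀ i, κ i → κ' i → ℝ) (b : ∀ i, κ i → ℝ) :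
    layerCost (blockDiag W) (fun p => b p.1 p.2) = ∑ i, layerCost (W i) (b i) := by
  unfold layerCost
  rw [Fintype.sum_sigma]
  refine Finset.sum_congr rfl fun i _ => Finset.sum_congr rfl fun k _ => ?_
  congr 1
  rw [Fintype.sum_sigma, Finset.sum_eq_single i]
  · simp [blockDiag]
  · intro j _ hj
    simp [blockDiag, hj]
  · simp

theorem sigma (hR : 0 ≤ R) {ι : Type} [Fintype ι] {κ : ι → Type} [∀ i, Fintype (κ i)]
    {P : ι → ℕ} {H : ∀ i, (Fin d → ℝ) → κ i → ℝ} (h : ∀ i, HidRep d R L (κ i) (P i) (H i)) :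
    HidRep d R L (Σ i, κ i) (∑ i, P i) (fun x p => H p.1 x p.2) := by
  induction L generalizing κ P with
  | zero =>
    choose W b hW hb hc hH using h
    refine ⟨fun p j => W p.1 p.2 j, fun p => b p.1 p.2, fun _ _ => hW _ _ _, fun _ => hb _ _,
      ?_, fun x p => hH p.1 x p.2⟩
    refine le_trans (le_of_eq ?_) (Finset.sum_le_sum fun i _ => hc i)
    unfold layerCost
    rw [Fintype.sum_sigma]
  | succ L ih =>
    choose κ' _ P' H' W b h' hW hb hc hH using h
    refine ⟨Σ i, κ' i, inferInstance, _, _, blockDiag W, fun p => b p.1 p.2, ih h',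
      abs_blockDiag_le hR W hW, fun _ => hb _ _, ?_, fun x p => ?_⟩
    · rw [layerCost_blockDiag, ← Finset.sum_add_distrib]
      exact Finset.sum_le_sum fun i _ => hc i
    · dsimp only
      rw [hH, sum_blockDiag_mul W p fun i l => H' i x l]

/-- A further layer on top of a net whose last layer has the pairs of values `relu (± F i)`. -/
theorem layer {ι κ : Type} [Fintype ι] [Fintype κ] {F : ι → (Fin d → ℝ) → ℝ}
    (h : HidRep d R L (ι × Bool) P (fun x p => relu (if p.2 then F p.1 x else -F p.1 x)))
    (W : κ → ι → ℝ) (b : κ → ℝ) (hW : ∀ i j, |W i j| ≤ R) (hb : ∀ i, |b i| ≤ R) :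
    HidRep d R (L + 1) κ (P + 2 * layerCost W b)
      (fun x i => relu ((∑ j, W i j * F j x) + b i)) := by
  refine ⟨ι × Bool, inferInstance, P, _, fun i p => if p.2 then W i p.1 else -W i p.1, b, h,
    fun i p => ?_, hb, ?_, fun x i => ?_⟩
  · dsimp only
    split_ifs
    · exact hW _ _
    · rw [abs_neg]; exact hW _ _
  · have : layerCost (fun i (p : ι × Bool) => if p.2 then W i p.1 else -W i p.1) b
        ≤ 2 * layerCost W b := by
      unfold layerCost
      rw [Finset.mul_sum]
      refine Finset.sum_le_sum fun i _ => ?_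
      rw [Fintype.sum_prod_type]
      simp only [Fintype.sum_bool, if_true, Bool.false_eq_true, if_false, neg_eq_zero,
        Finset.sum_add_distrib]
      omega
    omega
  · dsimp only
    congr 2
    rw [Fintype.sum_prod_type]
    refine Finset.sum_congr rfl fun j _ => ?_
    have : relu (F j x) - relu (-F j x) = F j x := by
      unfold relu
      rcases le_total (F j x) 0 with h0 | h0
      · rw [max_eq_right h0, max_eq_left (by linarith)]; ring
      · rw [max_eq_left h0, max_eq_right (by linarith)]; ring
    simp only [Fintype.sum_bool, if_true, Bool.false_eq_true, if_false]
    nth_rewrite 1 [← this]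
    ring

/-- A further layer, with the cost of its weights and thresholds added. -/
theorem succ {ι κ : Type} [Fintype ι] [Fintype κ] {H : (Fin d → ℝ) → ι → ℝ}
    (h : HidRep d R L ι P H) (W : κ → ι → ℝ) (b : κ → ℝ) (hW : ∀ i j, |W i j| ≤ R)
    (hb : ∀ i, |b i| ≤ R) :
    HidRep d R (L + 1) κ (P + layerCost W b) (fun x i => relu ((∑ j, W i j * H x j) + b i)) :=
  ⟨ι, inferInstance, P, H, W, b, h, hW, hb, le_rfl, fun _ _ => rfl⟩

end HidRep

theorem ReLUNet.numParams_eq {d : ℕ} (net : ReLUNet d) :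
    net.numParams = ∑ k ∈ Finset.range net.L, layerCost (net.W k) (net.b k)
      + (Finset.univ.filter fun i => net.a i ≠ 0).card := by
  unfold ReLUNet.numParams layerCost
  congr 1
  refine Finset.sum_congr rfl fun k _ => ?_
  rw [Finset.sum_add_distrib, Finset.card_filter, Finset.card_filter, Fintype.sum_prod_type]
  simp only [ne_eq, ite_not]

namespace ReLUNet

variable {d : ℕ}

/-- The first `L` layers of a net followed by one further layer. -/
def extend (net : ReLUNet d) (L m : ℕ) (W : Fin m → Fin (net.width L) → ℝ) (b : Fin m → ℝ) :
    ReLUNet d where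
  L := L + 1
  width k := if k ≤ L then net.width k else m
  width_zero := by simp [net.width_zero]
  W k i j :=
    if h : k < L then
      net.W k (Fin.cast (if_pos (show k + 1 ≤ L by omega)) i) (Fin.cast (if_pos h.le) j)
    else if h' : k = L then
      W (Fin.cast (if_neg (by omega)) i) (Fin.cast (by rw [if_pos h'.le, h']) j)
    else 0
  b k i :=
    if h : k < L then net.b k (Fin.cast (if_pos (show k + 1 ≤ L by omega)) i)
    else if h' : k = L then b (Fin.cast (if_neg (by omega)) i)
    else 0
  a _ := 0

variable (net : ReLUNet d) (L m : ℕ) (W : Fin m → Fin (net.width L) → ℝ) (b : Fin m → ℝ)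

theorem width_extend_of_le {k : ℕ} (h : k ≤ L) :
    (net.extend L m W b).width k = net.width k := if_pos h

theorem width_extend_succ : (net.extend L m W b).width (L + 1) = m := if_neg (by omega)

theorem W_extend_of_lt {k : ℕ} (h : k < L) : (net.extend L m W b).W k = fun i j =>
    net.W k (finCongr (net.width_extend_of_le L m W b h) i)
      (finCongr (net.width_extend_of_le L m W b h.le) j) := by
  funext i j
  simp [extend, h]
  rfl

theorem b_extend_of_lt {k : ℕ} (h : k < L) : (net.extend L m W b).b k = fun i =>
    net.b k (finCongr (net.width_extend_of_le L m W b h) i) := by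
  funext i
  simp [extend, h]
  rfl

theorem W_extend_self : (net.extend L m W b).W L = fun i j =>
    W (finCongr (net.width_extend_succ L m W b) i)
      (finCongr (net.width_extend_of_le L m W b le_rfl) j) := by
  funext i j
  simp [extend]
  rfl

theorem b_extend_self : (net.extend L m W b).b L = fun i =>
    b (finCongr (net.width_extend_succ L m W b) i) := by
  funext i
  simp [extend]
  rfl

theorem hidden_extend_of_le (x : Fin d → ℝ) {k : ℕ} (h : k ≤ L)
    (i : Fin ((net.extend L m W b).width k)) :
    (net.extend L m W b).hidden x k i =
      net.hidden x k (finCongr (net.width_extend_of_le L m W b h) i) := by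
  induction k with
  | zero => rfl
  | succ k ih =>
    simp only [hidden]
    rw [W_extend_of_lt _ _ _ _ _ h, b_extend_of_lt _ _ _ _ _ h,
      ← Equiv.sum_comp (finCongr (net.width_extend_of_le L m W b (Nat.le_of_succ_le h)))]
    congr 2
    exact Finset.sum_congr rfl fun j _ => by rw [ih (Nat.le_of_succ_le h)]

theorem hidden_extend_succ (x : Fin d → ℝ) (i : Fin ((net.extend L m W b).width (L + 1))) :
    (net.extend L m W b).hidden x (L + 1) i =
      relu ((∑ j, W (finCongr (net.width_extend_succ L m W b) i) j * net.hidden x L j)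
        + b (finCongr (net.width_extend_succ L m W b) i)) := by
  rw [hidden, W_extend_self, b_extend_self,
    ← Equiv.sum_comp (finCongr (net.width_extend_of_le L m W b le_rfl))]
  congr 2
  exact Finset.sum_congr rfl fun j _ => by rw [hidden_extend_of_le _ _ _ _ _ _ le_rfl]

theorem layerCost_extend_of_lt {k : ℕ} (h : k < L) :
    layerCost ((net.extend L m W b).W k) ((net.extend L m W b).b k)
      = layerCost (net.W k) (net.b k) := by
  rw [W_extend_of_lt _ _ _ _ _ h, b_extend_of_lt _ _ _ _ _ h]
  exact layerCost_comp_equiv _ _ _ _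

theorem layerCost_extend_self :
    layerCost ((net.extend L m W b).W L) ((net.extend L m W b).b L) = layerCost W b := by
  rw [W_extend_self, b_extend_self]
  exact layerCost_comp_equiv _ _ _ _

end ReLUNet

/-- A represented hidden layer is a hidden layer of a `ReLUNet`. -/
theorem HidRep.exists_net {d : ℕ} {R : ℝ} {L P : ℕ} {κ : Type} [Fintype κ]
    {H : (Fin d → ℝ) → κ → ℝ} (h : HidRep d R L κ P H) :
    ∃ net : ReLUNet d, (∀ k < L + 1, ∀ i j, |net.W k i j| ≤ R) ∧
      (∀ k < L + 1, ∀ i, |net.b k i| ≤ R) ∧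
      ∑ k ∈ Finset.range (L + 1), layerCost (net.W k) (net.b k) ≤ P ∧
      ∃ e : κ ≃ Fin (net.width (L + 1)), ∀ x i, H x i = net.hidden x (L + 1) (e i) := by
  suffices key : ∀ (L : ℕ) (net : ReLUNet d) (ι κ : Type) [Fintype ι] [Fintype κ]
      (H' : (Fin d → ℝ) → ι → ℝ) (H : (Fin d → ℝ) → κ → ℝ)
      (P P' : ℕ) (W : κ → ι → ℝ) (b : κ → ℝ) (e : ι ≃ Fin (net.width L)),
      (∀ k < L, ∀ i j, |net.W k i j| ≤ R) → (∀ k < L, ∀ i, |net.b k i| ≤ R) →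
      ∑ k ∈ Finset.range L, layerCost (net.W k) (net.b k) ≤ P' →
      (∀ x i, H' x i = net.hidden x L (e i)) →
      (∀ i j, |W i j| ≤ R) → (∀ i, |b i| ≤ R) → P' + layerCost W b ≤ P →
      (∀ x i, H x i = relu ((∑ j, W i j * H' x j) + b i)) →
      ∃ net : ReLUNet d, (∀ k < L + 1, ∀ i j, |net.W k i j| ≤ R) ∧
        (∀ k < L + 1, ∀ i, |net.b k i| ≤ R) ∧
        ∑ k ∈ Finset.range (L + 1), layerCost (net.W k) (net.b k) ≤ P ∧
        ∃ e : κ ≃ Fin (net.width (L + 1)), ∀ x i, H x i = net.hidden x (L + 1) (e i) by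
    induction L generalizing κ P with
    | zero =>
      obtain ⟨W, b, hW, hb, hc, hH⟩ := h
      let net₀ : ReLUNet d := ⟨0, fun _ => d, rfl, fun _ _ _ => 0, fun _ _ => 0, fun _ => 0⟩
      exact key 0 net₀ (Fin d) κ (fun x i => x i) H P 0 W b (Equiv.refl _) (by simp) (by simp)
        (by simp) (fun _ _ => rfl) hW hb (by omega) hH
    | succ L ih =>
      obtain ⟨ι, _, P', H', W, b, h', hW, hb, hc, hH⟩ := h
      obtain ⟨net, h1, h2, h3, e, h4⟩ := ih h'
      exact key (L + 1) net ι κ H' H P P' W b e h1 h2 h3 h4 hW hb hc hH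
  intro L net ι κ _ _ H' H P P' W b e h1 h2 h3 h4 hW hb hc hH
  let ε := Fintype.equivFin κ
  let W' : Fin (Fintype.card κ) → Fin (net.width L) → ℝ := fun i j => W (ε.symm i) (e.symm j)
  let b' : Fin (Fintype.card κ) → ℝ := fun i => b (ε.symm i)
  refine ⟨net.extend L (Fintype.card κ) W' b', ?_, ?_, ?_,
    ε.trans (finCongr (net.width_extend_succ L _ W' b')).symm, ?_⟩
  · intro k hk i j
    rcases Nat.lt_succ_iff_lt_or_eq.1 hk with hk | rfl
    · rw [ReLUNet.W_extend_of_lt _ _ _ _ _ hk]; exact h1 k hk _ _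
    · rw [ReLUNet.W_extend_self]; exact hW _ _
  · intro k hk i
    rcases Nat.lt_succ_iff_lt_or_eq.1 hk with hk | rfl
    · rw [ReLUNet.b_extend_of_lt _ _ _ _ _ hk]; exact h2 k hk _
    · rw [ReLUNet.b_extend_self]; exact hb _
  · rw [Finset.sum_range_succ, ReLUNet.layerCost_extend_self,
      Finset.sum_congr rfl fun k hk =>
        ReLUNet.layerCost_extend_of_lt net L _ W' b' (Finset.mem_range.1 hk),
      show layerCost W' b' = layerCost W b from layerCost_comp_equiv ε.symm e.symm W b]
    omega
  · intro x i
    rw [hH, ReLUNet.hidden_extend_succ]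
    simp only [Equiv.trans_apply, Equiv.apply_symm_apply, W', b', Equiv.symm_apply_apply, ε]
    rw [← Equiv.sum_comp e]
    simp only [Equiv.symm_apply_apply, h4]

theorem HidRep.exists_net_eval {d : ℕ} {R : ℝ} (hR : 1 ≤ R) {L P : ℕ} {F : (Fin d → ℝ) → ℝ}
    (h : HidRep d R L Bool P (fun x b => relu (if b then F x else -F x))) :
    ∃ net : ReLUNet d, net.L = L + 1 ∧ net.numParams ≤ P + 2 ∧ net.paramBound R ∧
      ∀ x, net.eval x = F x := by
  obtain ⟨net, h1, h2, h3, e, h4⟩ := h.exists_net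
  refine ⟨{ net with L := L + 1, a := fun i => if e.symm i then 1 else -1 }, rfl, ?_,
    ⟨h1, h2, ?_⟩, ?_⟩
  · rw [ReLUNet.numParams_eq]
    refine add_le_add h3 ((Finset.card_le_univ _).trans ?_)
    rw [← Fintype.card_congr e, Fintype.card_bool]
  · intro i
    dsimp only
    split_ifs <;> simpa using hR
  · intro x
    have hhid : ∀ (k : ℕ) (i : Fin (net.width k)),
        ReLUNet.hidden { net with L := L + 1, a := fun i => if e.symm i then 1 else -1 } x k i
          = net.hidden x k i := by
      intro k
      induction k with
      | zero => intro i; rfl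
      | succ k ih => intro i; simp only [ReLUNet.hidden, ih]
    unfold ReLUNet.eval
    simp only [hhid]
    rw [← Equiv.sum_comp e]
    simp only [← h4, Equiv.symm_apply_apply, Fintype.sum_bool, if_true, Bool.false_eq_true,
      if_false, relu]
    rcases le_total (F x) 0 with h0 | h0
    · rw [max_eq_right h0, max_eq_left (by linarith)]; ring
    · rw [max_eq_left h0, max_eq_right (by linarith)]; ring

/-! ### Sequences of nets of linear size -/

theorem layerCost_le {κ ι : Type} [Fintype κ] [Fintype ι] (W : κ → ι → ℝ) (b : κ → ℝ) :
    layerCost W b ≤ Fintype.card κ * (Fintype.card ι + 1) := by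
  unfold layerCost
  refine (Finset.sum_le_card_nsmul _ _ (Fintype.card ι + 1) fun i _ => ?_).trans (by simp)
  refine add_le_add ((Finset.sum_le_card_nsmul _ _ 1 fun j _ => ?_).trans (by simp)) ?_ <;>
    split_ifs <;> simp

/-- `NetSeq d L F`: the functions `F n`, `n ≥ 1`, are computed from the hidden layer `L + 1` of
nets with `O(n)` nonzero parameters which are polynomially bounded in `n`. -/
def NetSeq (d L : ℕ) (F : ℕ → (Fin d → ℝ) → ℝ) : Prop :=
  ∃ C K : ℕ, ∀ n : ℕ, 1 ≤ n → HidRep d ((C : ℝ) * (n : ℝ) ^ K) L Bool (C * n)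
    (fun x b => relu (if b then F n x else -F n x))

theorem mul_pow_le_mul_pow {C C' K K' n : ℕ} (hn : 1 ≤ n) (hC : C ≤ C') (hK : K ≤ K') :
    (C : ℝ) * (n : ℝ) ^ K ≤ (C' : ℝ) * (n : ℝ) ^ K' := by
  have h1 : (1 : ℝ) ≤ n := by exact_mod_cast hn
  have h2 : (C : ℝ) ≤ C' := by exact_mod_cast hC
  exact mul_le_mul h2 (pow_le_pow_right₀ h1 hK) (by positivity) (by positivity)

namespace NetSeq

variable {d L : ℕ}

theorem family {ι : Type} [Fintype ι] {F : ι → ℕ → (Fin d → ℝ) → ℝ}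
    (hF : ∀ i, NetSeq d L (F i)) :
    ∃ C K : ℕ, ∀ n : ℕ, 1 ≤ n → HidRep d ((C : ℝ) * (n : ℝ) ^ K) L (ι × Bool) (C * n)
      (fun x p => relu (if p.2 then F p.1 n x else -F p.1 n x)) := by
  choose C K h using hF
  refine ⟨∑ i, C i, ∑ i, K i, fun n hn => ?_⟩
  have h' : ∀ i, HidRep d (((∑ i, C i : ℕ) : ℝ) * (n : ℝ) ^ (∑ i, K i)) L Bool (C i * n)
      (fun x b => relu (if b then F i n x else -F i n x)) := fun i =>
    (h i n hn).mono (mul_pow_le_mul_pow hn (Finset.single_le_sum (fun _ _ => Nat.zero_le _)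
      (Finset.mem_univ i)) (Finset.single_le_sum (fun _ _ => Nat.zero_le _)
      (Finset.mem_univ i))) le_rfl
  have := (HidRep.sigma (by positivity) h').reindex (Equiv.sigmaEquivProd ι Bool).symm
  rw [← Finset.sum_mul] at this
  exact this

theorem affine {a : ℕ → Fin d → ℝ} {c : ℕ → ℝ} {C K : ℕ}
    (ha : ∀ n, 1 ≤ n → ∀ i, |a n i| ≤ (C : ℝ) * (n : ℝ) ^ K)
    (hc : ∀ n, 1 ≤ n → |c n| ≤ (C : ℝ) * (n : ℝ) ^ K) :
    NetSeq d 0 (fun n x => (∑ i, a n i * x i) + c n) := by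
  refine ⟨C + 2 * (d + 1), K, fun n hn => ?_⟩
  have hle := mul_pow_le_mul_pow hn (show C ≤ C + 2 * (d + 1) by omega) (le_refl K)
  refine ⟨fun b i => if b then a n i else -a n i, fun b => if b then c n else -c n,
    fun b i => ?_, fun b => ?_, ?_, fun x b => ?_⟩
  · cases b <;> simpa using (ha n hn i).trans hle
  · cases b <;> simpa using (hc n hn).trans hle
  · refine (layerCost_le _ _).trans ?_
    simp only [Fintype.card_bool, Fintype.card_fin]
    nlinarith
  · cases b
    · simp only [Bool.false_eq_true, if_false, neg_add, neg_mul, Finset.sum_neg_distrib]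
    · simp only [if_true]

/-- Passing `O(n)` hidden values through a linear readout. -/
theorem of_layer {Q : ℕ → Type} [∀ n, Fintype (Q n)] {G : ∀ n, (Fin d → ℝ) → Q n → ℝ}
    {C K : ℕ} (hG : ∀ n : ℕ, 1 ≤ n → HidRep d ((C : ℝ) * (n : ℝ) ^ K) L (Q n) (C * n) (G n))
    (B : ∀ n, Q n → ℝ) (c : ℕ → ℝ) {C' K' : ℕ} (hcard : ∀ n, 1 ≤ n → Fintype.card (Q n) ≤ C' * n)
    (hB : ∀ n, 1 ≤ n → ∀ q, |B n q| ≤ (C' : ℝ) * (n : ℝ) ^ K')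
    (hc : ∀ n, 1 ≤ n → |c n| ≤ (C' : ℝ) * (n : ℝ) ^ K') :
    NetSeq d (L + 1) (fun n x => (∑ q, B n q * G n x q) + c n) := by
  refine ⟨C + 2 * (C' + 1), K + K', fun n hn => ?_⟩
  have h1 := mul_pow_le_mul_pow hn (show C ≤ C + 2 * (C' + 1) by omega) (show K ≤ K + K' by omega)
  have h2 := mul_pow_le_mul_pow hn (show C' ≤ C + 2 * (C' + 1) by omega)
    (show K' ≤ K + K' by omega)
  have key := ((hG n hn).mono h1 le_rfl).succ
    (fun (b : Bool) q => if b then B n q else -B n q) (fun b => if b then c n else -c n)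
    (fun b q => by cases b <;> simpa using (hB n hn q).trans h2)
    (fun b => by cases b <;> simpa using (hc n hn).trans h2)
  have hcost := layerCost_le (fun (b : Bool) q => if b then B n q else -B n q)
    (fun b => if b then c n else -c n)
  rw [Fintype.card_bool] at hcost
  have h3 := hcard n hn
  convert key.mono le_rfl (show _ ≤ (C + 2 * (C' + 1)) * n by nlinarith) using 3 with x b
  cases b
  · simp only [Bool.false_eq_true, if_false, neg_add, neg_mul, Finset.sum_neg_distrib]
  · simp only [if_true]

theorem linComb {ι : Type} [Fintype ι] {F : ι → ℕ → (Fin d → ℝ) → ℝ}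
    (hF : ∀ i, NetSeq d L (F i)) (a : ℕ → ι → ℝ) (c : ℕ → ℝ) {C' K' : ℕ}
    (ha : ∀ n, 1 ≤ n → ∀ i, |a n i| ≤ (C' : ℝ) * (n : ℝ) ^ K')
    (hc : ∀ n, 1 ≤ n → |c n| ≤ (C' : ℝ) * (n : ℝ) ^ K') :
    NetSeq d (L + 1) (fun n x => (∑ i, a n i * F i n x) + c n) := by
  obtain ⟨C, K, h⟩ := family hF
  have key := of_layer h (fun n p => if p.2 then a n p.1 else -a n p.1) c
    (C' := C' + Fintype.card (ι × Bool)) (K' := K') (fun n hn => by nlinarith)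
    (fun n hn p => ?_)
    (fun n hn => (hc n hn).trans (mul_pow_le_mul_pow hn (by omega) le_rfl))
  · convert key using 4 with n x
    rw [Fintype.sum_prod_type]
    refine Finset.sum_congr rfl fun i _ => ?_
    have : relu (F i n x) - relu (-F i n x) = F i n x := by
      unfold relu
      rcases le_total (F i n x) 0 with h0 | h0
      · rw [max_eq_right h0, max_eq_left (by linarith)]; ring
      · rw [max_eq_left h0, max_eq_right (by linarith)]; ring
    simp only [Fintype.sum_bool, if_true, Bool.false_eq_true, if_false]
    nth_rewrite 1 [← this]
    ring
  · have := (ha n hn p.1).trans (mul_pow_le_mul_pow hn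
      (show C' ≤ C' + Fintype.card (ι × Bool) by omega) le_rfl)
    split_ifs
    · exact this
    · rwa [abs_neg]

theorem hiddenUnits {ι : Type} [Fintype ι] {F : ι → ℕ → (Fin d → ℝ) → ℝ}
    (hF : ∀ i, NetSeq d L (F i)) {Q : ℕ → Type} [∀ n, Fintype (Q n)]
    (A : ∀ n, Q n → ι → ℝ) (e : ∀ n, Q n → ℝ) {C' K' : ℕ}
    (hcard : ∀ n, 1 ≤ n → Fintype.card (Q n) ≤ C' * n)
    (hA : ∀ n, 1 ≤ n → ∀ q i, |A n q i| ≤ (C' : ℝ) * (n : ℝ) ^ K')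
    (he : ∀ n, 1 ≤ n → ∀ q, |e n q| ≤ (C' : ℝ) * (n : ℝ) ^ K') :
    ∃ C K : ℕ, ∀ n : ℕ, 1 ≤ n → HidRep d ((C : ℝ) * (n : ℝ) ^ K) (L + 1) (Q n) (C * n)
      (fun x q => relu ((∑ i, A n q i * F i n x) + e n q)) := by
  obtain ⟨C, K, h⟩ := family hF
  refine ⟨C + 2 * (C' * (Fintype.card ι + 1)) + C', K + K', fun n hn => ?_⟩
  set C₁ := C + 2 * (C' * (Fintype.card ι + 1)) + C'
  have h1 := mul_pow_le_mul_pow hn (show C ≤ C₁ by simp only [C₁]; omega)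
    (show K ≤ K + K' by omega)
  have h2 := mul_pow_le_mul_pow hn (show C' ≤ C₁ by simp only [C₁]; omega)
    (show K' ≤ K + K' by omega)
  refine (((h n hn).mono h1 le_rfl).layer (F := fun i => F i n) (A n) (e n)
    (fun q i => (hA n hn q i).trans h2) (fun q => (he n hn q).trans h2)).mono le_rfl ?_
  have hcost := (layerCost_le (A n) (e n)).trans
    (Nat.mul_le_mul_right (Fintype.card ι + 1) (hcard n hn))
  calc C * n + 2 * layerCost (A n) (e n) ≤ C * n + 2 * (C' * n * (Fintype.card ι + 1)) := by
        omega
    _ = (C + 2 * (C' * (Fintype.card ι + 1))) * n := by ring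
    _ ≤ C₁ * n := Nat.mul_le_mul_right _ (by simp only [C₁]; omega)

theorem shallow {ι : Type} [Fintype ι] {F : ι → ℕ → (Fin d → ℝ) → ℝ}
    (hF : ∀ i, NetSeq d L (F i)) {Q : ℕ → Type} [∀ n, Fintype (Q n)]
    (A : ∀ n, Q n → ι → ℝ) (e B : ∀ n, Q n → ℝ) (c : ℕ → ℝ) {C' K' : ℕ}
    (hcard : ∀ n, 1 ≤ n → Fintype.card (Q n) ≤ C' * n)
    (hA : ∀ n, 1 ≤ n → ∀ q i, |A n q i| ≤ (C' : ℝ) * (n : ℝ) ^ K')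
    (he : ∀ n, 1 ≤ n → ∀ q, |e n q| ≤ (C' : ℝ) * (n : ℝ) ^ K')
    (hB : ∀ n, 1 ≤ n → ∀ q, |B n q| ≤ (C' : ℝ) * (n : ℝ) ^ K')
    (hc : ∀ n, 1 ≤ n → |c n| ≤ (C' : ℝ) * (n : ℝ) ^ K') :
    NetSeq d (L + 2)
      (fun n x => (∑ q, B n q * relu ((∑ i, A n q i * F i n x) + e n q)) + c n) := by
  obtain ⟨C, K, h⟩ := hiddenUnits hF A e hcard hA he
  exact of_layer h B c hcard hB hc

theorem shallow_two {ι : Type} [Fintype ι] {F : ι → ℕ → (Fin d → ℝ) → ℝ}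
    (hF : ∀ i, NetSeq d L (F i)) {Q Q' : ℕ → Type} [∀ n, Fintype (Q n)] [∀ n, Fintype (Q' n)]
    (A : ∀ n, Q n → ι → ℝ) (e : ∀ n, Q n → ℝ) (D : ∀ n, Q' n → Q n → ℝ) (e' B : ∀ n, Q' n → ℝ)
    {C' K' : ℕ}
    (hcard : ∀ n, 1 ≤ n → Fintype.card (Q n) ≤ C' * n)
    (hcard' : ∀ n, 1 ≤ n → Fintype.card (Q' n) ≤ C' * n)
    (hcost : ∀ n, 1 ≤ n → layerCost (D n) (e' n) ≤ C' * n)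
    (hA : ∀ n, 1 ≤ n → ∀ q i, |A n q i| ≤ (C' : ℝ) * (n : ℝ) ^ K')
    (he : ∀ n, 1 ≤ n → ∀ q, |e n q| ≤ (C' : ℝ) * (n : ℝ) ^ K')
    (hD : ∀ n, 1 ≤ n → ∀ q' q, |D n q' q| ≤ (C' : ℝ) * (n : ℝ) ^ K')
    (he' : ∀ n, 1 ≤ n → ∀ q, |e' n q| ≤ (C' : ℝ) * (n : ℝ) ^ K')
    (hB : ∀ n, 1 ≤ n → ∀ q, |B n q| ≤ (C' : ℝ) * (n : ℝ) ^ K') :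
    NetSeq d (L + 3) (fun n x => ∑ q', B n q' *
      relu ((∑ q, D n q' q * relu ((∑ i, A n q i * F i n x) + e n q)) + e' n q')) := by
  obtain ⟨C, K, h⟩ := hiddenUnits hF A e hcard hA he
  have h' : ∀ n : ℕ, 1 ≤ n → HidRep d (((C + C' : ℕ) : ℝ) * (n : ℝ) ^ (K + K')) (L + 2) (Q' n)
      ((C + C') * n) (fun x q' =>
        relu ((∑ q, D n q' q * relu ((∑ i, A n q i * F i n x) + e n q)) + e' n q')) := by
    intro n hn
    have h1 := mul_pow_le_mul_pow hn (show C ≤ C + C' by omega) (show K ≤ K + K' by omega)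
    have h2 := mul_pow_le_mul_pow hn (show C' ≤ C + C' by omega) (show K' ≤ K + K' by omega)
    refine (((h n hn).mono h1 le_rfl).succ (D n) (e' n) (fun q' q => (hD n hn q' q).trans h2)
      (fun q' => (he' n hn q').trans h2)).mono le_rfl ?_
    rw [add_mul]
    exact Nat.add_le_add_left (hcost n hn) _
  have := of_layer h' B (fun _ => 0) hcard' hB (fun n hn => by simp; positivity)
  simpa using this

theorem succ {F : ℕ → (Fin d → ℝ) → ℝ} (hF : NetSeq d L F) : NetSeq d (L + 1) F := by
  have := linComb (ι := Unit) (fun _ => hF) (fun _ _ => 1) (fun _ => 0) (C' := 1) (K' := 0)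
    (by simp) (by simp)
  simpa using this

theorem mono {L' : ℕ} (h : L ≤ L') {F : ℕ → (Fin d → ℝ) → ℝ} (hF : NetSeq d L F) :
    NetSeq d L' F := by
  induction L', h using Nat.le_induction with
  | base => exact hF
  | succ L' _ ih => exact ih.succ

theorem coord (i : Fin d) : NetSeq d 0 (fun _ x => x i) := by
  have := affine (d := d) (a := fun _ j => if j = i then 1 else 0) (c := fun _ => 0) (C := 1)
    (K := 0) (fun n _ j => by split_ifs <;> simp) (by simp)
  simpa using this

theorem const (c : ℝ) : NetSeq d 0 (fun _ _ => c) := by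
  have := affine (d := d) (a := fun _ _ => 0) (c := fun _ => c) (C := ⌈|c|⌉₊) (K := 0)
    (fun n _ j => by simp) (fun n _ => by simpa using Nat.le_ceil _)
  simpa using this

/-- `shallow` for a single input. -/
theorem shallow_one {F : ℕ → (Fin d → ℝ) → ℝ} (hF : NetSeq d L F) {Q : ℕ → Type}
    [∀ n, Fintype (Q n)] (A e B : ∀ n, Q n → ℝ) (c : ℕ → ℝ) (C' K' : ℕ)
    (hcard : ∀ n, 1 ≤ n → Fintype.card (Q n) ≤ C' * n)
    (hA : ∀ n, 1 ≤ n → ∀ q, |A n q| ≤ (C' : ℝ) * (n : ℝ) ^ K')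
    (he : ∀ n, 1 ≤ n → ∀ q, |e n q| ≤ (C' : ℝ) * (n : ℝ) ^ K')
    (hB : ∀ n, 1 ≤ n → ∀ q, |B n q| ≤ (C' : ℝ) * (n : ℝ) ^ K')
    (hc : ∀ n, 1 ≤ n → |c n| ≤ (C' : ℝ) * (n : ℝ) ^ K') :
    NetSeq d (L + 2) (fun n x => (∑ q, B n q * relu (A n q * F n x + e n q)) + c n) := by
  have := shallow (ι := Unit) (fun _ => hF) (fun n q _ => A n q) e B c hcard
    (fun n hn q _ => hA n hn q) he hB hc
  simpa using this

/-- Affine combinations with constant coefficients. -/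
theorem linComb_const {ι : Type} [Fintype ι] {F : ι → ℕ → (Fin d → ℝ) → ℝ}
    (hF : ∀ i, NetSeq d L (F i)) (a : ι → ℝ) :
    NetSeq d (L + 1) (fun n x => ∑ i, a i * F i n x) := by
  have := linComb hF (fun _ => a) (fun _ => 0) (C' := ∑ i, ⌈|a i|⌉₊) (K' := 0)
    (fun n _ i => ?_) (fun n _ => by simp; positivity)
  · simpa using this
  · rw [pow_zero, mul_one]
    refine (Nat.le_ceil _).trans ?_
    exact_mod_cast Finset.single_le_sum (f := fun i => ⌈|a i|⌉₊) (fun _ _ => Nat.zero_le _)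
      (Finset.mem_univ i)

end NetSeq

/-! ### Approximate multiplication -/

theorem relu_of_nonneg {t : ℝ} (h : 0 ≤ t) : relu t = t := max_eq_left h

theorem relu_of_nonpos {t : ℝ} (h : t ≤ 0) : relu t = 0 := max_eq_right h

/-- The coefficients of the zigzag function in the basis `relu (w - k)`. -/
def zigzagCoeff (k : ℕ) : ℝ := if k = 0 then 1 else 2 * (-1) ^ k

/-- The coefficients of the interpolant of `u (1 - u)` at the nodes `k / M`. -/
def chordCoeff (M k : ℕ) : ℝ := if k = 0 then (1 - 1 / M) / M else -2 / (M : ℝ) ^ 2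

/-- The sawtooth function on `[0, 1]` with `M` monotone pieces. -/
def sawtooth (M : ℕ) (u : ℝ) : ℝ := ∑ k : Fin M, zigzagCoeff k * relu (M * u + -(k : ℝ))

/-- The piecewise linear interpolant of `u (1 - u)` at the nodes `k / M`. -/
def chord (M : ℕ) (u : ℝ) : ℝ := ∑ k : Fin M, chordCoeff M k * relu (M * u + -(k : ℝ))

theorem sum_coeff_mul_relu {M m : ℕ} (hm : m < M) {w : ℝ} (h0 : (m : ℝ) ≤ w) (h1 : w ≤ m + 1)
    (c : ℕ → ℝ) :
    ∑ k : Fin M, c k * relu (w + -(k : ℝ)) = ∑ k ∈ Finset.range (m + 1), c k * (w - k) := by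
  rw [Fin.sum_univ_eq_sum_range (fun k => c k * relu (w + -(k : ℝ))) M,
    ← Finset.sum_subset (Finset.range_mono (Nat.succ_le_of_lt hm))]
  · refine Finset.sum_congr rfl fun k hk => ?_
    have : (k : ℝ) ≤ m := by exact_mod_cast Nat.lt_succ_iff.1 (Finset.mem_range.1 hk)
    rw [relu_of_nonneg (by linarith), sub_eq_add_neg]
  · intro k _ hk
    have : (m : ℝ) + 1 ≤ k := by
      rw [Finset.mem_range, not_lt] at hk
      exact_mod_cast hk
    rw [relu_of_nonpos (by linarith), mul_zero]

theorem sum_zigzagCoeff (m : ℕ) (w : ℝ) :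
    ∑ k ∈ Finset.range (m + 1), zigzagCoeff k * (w - k) = 1 / 2 + (-1) ^ m * (w - m - 1 / 2) := by
  induction m with
  | zero => simp [zigzagCoeff]
  | succ m ih =>
    rw [Finset.sum_range_succ, ih, zigzagCoeff, if_neg (Nat.succ_ne_zero m)]
    push_cast
    ring

theorem sum_chordCoeff {M : ℕ} (m : ℕ) (w : ℝ) :
    ∑ k ∈ Finset.range (m + 1), chordCoeff M k * (w - k) =
      (1 - (2 * m + 1) / M) / M * (w - m) + m / M * (1 - m / M) := by
  induction m with
  | zero => simp [chordCoeff]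
  | succ m ih =>
    rw [Finset.sum_range_succ, ih, chordCoeff, if_neg (Nat.succ_ne_zero m)]
    push_cast
    ring

theorem exists_piece {M : ℕ} (hM : 1 ≤ M) {w : ℝ} (h0 : 0 ≤ w) (h1 : w ≤ M) :
    ∃ m : ℕ, m < M ∧ (m : ℝ) ≤ w ∧ w ≤ m + 1 := by
  rcases h1.lt_or_eq with h | rfl
  · exact ⟨⌊w⌋₊, (Nat.floor_lt h0).2 h, Nat.floor_le h0, (Nat.lt_floor_add_one w).le⟩
  · refine ⟨M - 1, by omega, ?_, ?_⟩ <;> rw [Nat.cast_sub hM] <;> simp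

theorem sawtooth_chord {M : ℕ} (hM : 1 ≤ M) {u : ℝ} (h0 : 0 ≤ u) (h1 : u ≤ 1) :
    sawtooth M u ∈ Set.Icc (0 : ℝ) 1 ∧
      u * (1 - u) = chord M u + sawtooth M u * (1 - sawtooth M u) / (M : ℝ) ^ 2 := by
  have hM' : (0 : ℝ) < M := by exact_mod_cast hM
  obtain ⟨m, hm, hm0, hm1⟩ := exists_piece hM (show 0 ≤ M * u by positivity)
    (show M * u ≤ M by nlinarith)
  have hs : sawtooth M u = 1 / 2 + (-1) ^ m * (M * u - m - 1 / 2) := by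
    rw [sawtooth, sum_coeff_mul_relu hm hm0 hm1, sum_zigzagCoeff]
  have hc : chord M u = (1 - (2 * m + 1) / M) / M * (M * u - m) + m / M * (1 - m / M) := by
    rw [chord, sum_coeff_mul_relu hm hm0 hm1, sum_chordCoeff]
  rcases neg_one_pow_eq_or ℝ m with h | h <;> rw [hs, hc, h]
  · refine ⟨⟨by linarith, by linarith⟩, ?_⟩
    field_simp
    ring
  · refine ⟨⟨by linarith, by linarith⟩, ?_⟩
    field_simp
    ring

/-- An approximation of `u (1 - u)` built from iterated sawtooth functions. -/
def parabolaApprox (M l : ℕ) (u : ℝ) : ℝ :=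
  ∑ j : Fin l, 1 / ((M : ℝ) ^ 2) ^ (j : ℕ) * chord M ((sawtooth M)^[j] u)

theorem parabolaApprox_spec {M : ℕ} (hM : 1 ≤ M) (l : ℕ) {u : ℝ} (h0 : 0 ≤ u) (h1 : u ≤ 1) :
    |parabolaApprox M l u - u * (1 - u)| ≤ 1 / ((M : ℝ) ^ 2) ^ l := by
  have hM' : (0 : ℝ) < M := by exact_mod_cast hM
  have key : (sawtooth M)^[l] u ∈ Set.Icc (0 : ℝ) 1 ∧
      u * (1 - u) = parabolaApprox M l u +
        (sawtooth M)^[l] u * (1 - (sawtooth M)^[l] u) / ((M : ℝ) ^ 2) ^ l := by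
    induction l with
    | zero => simp [parabolaApprox, h0, h1]
    | succ l ih =>
      obtain ⟨hm, he⟩ := ih
      obtain ⟨hm', he'⟩ := sawtooth_chord hM hm.1 hm.2
      rw [Function.iterate_succ_apply']
      refine ⟨hm', ?_⟩
      rw [he, he', parabolaApprox, parabolaApprox, Fin.sum_univ_castSucc]
      simp only [Fin.val_castSucc, Fin.val_last]
      field_simp
      ring
  obtain ⟨⟨hm0, hm1⟩, he⟩ := key
  rw [he, sub_add_cancel_left, abs_neg, abs_of_nonneg
    (div_nonneg (mul_nonneg hm0 (by linarith)) (by positivity))]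
  gcongr
  nlinarith

namespace NetSeq

variable {d L : ℕ}

theorem abs {F : ℕ → (Fin d → ℝ) → ℝ} (hF : NetSeq d L F) :
    NetSeq d (L + 2) (fun n x => |F n x|) := by
  have := shallow_one hF (Q := fun _ => Bool) (fun _ b => if b then 1 else -1) (fun _ _ => 0)
    (fun _ _ => 1) (fun _ => 0) 2 0 (fun n hn => by simp; omega)
    (fun n hn b => by cases b <;> simp) (fun n hn b => by simp) (fun n hn b => by simp)
    (fun n hn => by simp)
  convert this using 3 with n x
  rcases le_total (F n x) 0 with h | h
  · simp [abs_of_nonpos h, relu, h]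
  · simp [abs_of_nonneg h, relu, h]

theorem clip {F : ℕ → (Fin d → ℝ) → ℝ} (hF : NetSeq d L F) :
    NetSeq d (L + 2) (fun n x => max (-1) (min 1 (F n x))) := by
  have := shallow_one hF (Q := fun _ => Bool) (fun _ _ => 1) (fun _ b => if b then 1 else -1)
    (fun _ b => if b then 1 else -1) (fun _ => -1) 2 0 (fun n hn => by simp; omega)
    (fun n hn b => by simp) (fun n hn b => by cases b <;> simp)
    (fun n hn b => by cases b <;> simp) (fun n hn => by simp)
  convert this using 3 with n x
  simp only [Fintype.sum_bool, if_true, Bool.false_eq_true, if_false, one_mul, relu]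
  rcases le_total (F n x) 1 with h | h
  · rw [min_eq_right h, max_eq_right (a := F n x + -1) (by linarith)]
    rcases le_total (F n x) (-1) with h' | h'
    · rw [max_eq_left h', max_eq_right (by linarith)]; ring
    · rw [max_eq_right h', max_eq_left (by linarith)]; ring
  · rw [min_eq_left h, max_eq_left (a := F n x + -1) (by linarith),
      max_eq_right (by linarith), max_eq_left (by linarith)]
    ring

theorem clip_zero {F : ℕ → (Fin d → ℝ) → ℝ} (hF : NetSeq d L F) :
    NetSeq d (L + 2) (fun n x => max 0 (min 1 (F n x))) := by
  have := shallow_one hF (Q := fun _ => Bool) (fun _ _ => 1) (fun _ b => if b then 0 else -1)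
    (fun _ b => if b then 1 else -1) (fun _ => 0) 2 0 (fun n hn => by simp; omega)
    (fun n hn b => by simp) (fun n hn b => by cases b <;> simp)
    (fun n hn b => by cases b <;> simp) (fun n hn => by simp)
  convert this using 3 with n x
  simp only [Fintype.sum_bool, if_true, Bool.false_eq_true, if_false, one_mul, relu]
  rcases le_total (F n x) 1 with h | h
  · rw [min_eq_right h, max_eq_right (a := F n x + -1) (by linarith), max_comm, add_zero]
    ring_nf
  · rw [min_eq_left h, max_eq_left (a := F n x + -1) (by linarith),
      max_eq_right (by linarith), max_eq_left (by linarith)]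
    ring

theorem relu_sum {F : ℕ → (Fin d → ℝ) → ℝ} (hF : NetSeq d L F) (c : ℕ → ℕ → ℝ)
    (hc : ∀ n, 1 ≤ n → ∀ k, |c n k| ≤ 3) :
    NetSeq d (L + 2) (fun n x => ∑ k : Fin n, c n k * relu (n * F n x + -(k : ℝ))) := by
  have := shallow_one hF (Q := fun n => Fin n) (fun n _ => n) (fun _ k => -(k : ℝ))
    (fun n k => c n k) (fun _ => 0) 3 1 (fun n hn => by simp; omega)
    (fun n hn k => by rw [Nat.abs_cast, pow_one]; push_cast; linarith [Nat.cast_nonneg (α := ℝ) n])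
    (fun n hn k => by
      rw [abs_neg, Nat.abs_cast, pow_one]
      have : (k : ℝ) ≤ n := by exact_mod_cast k.2.le
      push_cast
      linarith [Nat.cast_nonneg (α := ℝ) n])
    (fun n hn k => (hc n hn k).trans (by
      have : (1 : ℝ) ≤ n := by exact_mod_cast hn
      rw [pow_one]; push_cast; linarith))
    (fun n hn => by simp)
  simpa using this

theorem sawtooth {F : ℕ → (Fin d → ℝ) → ℝ} (hF : NetSeq d L F) :
    NetSeq d (L + 2) (fun n x => _root_.sawtooth n (F n x)) := by
  refine relu_sum hF (fun _ => zigzagCoeff) fun n _ k => ?_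
  unfold zigzagCoeff
  split_ifs <;> norm_num [abs_mul]

theorem chord {F : ℕ → (Fin d → ℝ) → ℝ} (hF : NetSeq d L F) :
    NetSeq d (L + 2) (fun n x => _root_.chord n (F n x)) := by
  refine relu_sum hF chordCoeff fun n hn k => ?_
  have h1 : (1 : ℝ) ≤ n := by exact_mod_cast hn
  have h2 : 1 / (n : ℝ) ≤ 1 := by rw [div_le_one (by linarith)]; exact h1
  have h3 : 0 < 1 / (n : ℝ) := by positivity
  unfold chordCoeff
  split_ifs
  · rw [show (1 - 1 / (n : ℝ)) / n = (1 - 1 / n) * (1 / n) by ring, abs_of_nonneg (by nlinarith)]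
    nlinarith
  · rw [show -2 / (n : ℝ) ^ 2 = -(2 * (1 / n) ^ 2) by ring, abs_neg, abs_of_nonneg (by positivity)]
    nlinarith

theorem parabolaApprox {F : ℕ → (Fin d → ℝ) → ℝ} (hF : NetSeq d L F) (l : ℕ) :
    NetSeq d (L + 2 * l + 1) (fun n x => _root_.parabolaApprox n l (F n x)) := by
  have hs : ∀ j, NetSeq d (L + 2 * j) (fun n x => (_root_.sawtooth n)^[j] (F n x)) := by
    intro j
    induction j with
    | zero => exact hF
    | succ j ih =>
      simp only [Function.iterate_succ_apply']
      exact ih.sawtooth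
  have hc : ∀ j : Fin l, NetSeq d (L + 2 * l)
      (fun n x => _root_.chord n ((_root_.sawtooth n)^[j] (F n x))) := fun j =>
    (hs j).chord.mono (by have := j.2; omega)
  have := linComb hc (fun n j => 1 / ((n : ℝ) ^ 2) ^ (j : ℕ)) (fun _ => 0) (C' := 1) (K' := 0)
    (fun n hn j => ?_) (by simp)
  · simpa [_root_.parabolaApprox] using this
  · have h1 : (1 : ℝ) ≤ ((n : ℝ) ^ 2) ^ (j : ℕ) :=
      one_le_pow₀ (one_le_pow₀ (by exact_mod_cast hn))
    rw [abs_of_nonneg (by positivity), div_le_iff₀ (by linarith)]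
    simpa using h1

end NetSeq

/-- `ApproxSeq d L l f`: the functions `f n` are approximated on the cube up to `O(n ^ (-2 l))` by
a `NetSeq` with values in `[-1, 1]`. -/
def ApproxSeq (d L l : ℕ) (f : ℕ → (Fin d → ℝ) → ℝ) : Prop :=
  ∃ F : ℕ → (Fin d → ℝ) → ℝ, NetSeq d L F ∧ (∀ n, 1 ≤ n → ∀ x ∈ cube d, |F n x| ≤ 1) ∧
    ∃ C : ℝ, 0 ≤ C ∧ ∀ n : ℕ, 1 ≤ n → ∀ x ∈ cube d, |F n x - f n x| ≤ C * (1 / ((n : ℝ) ^ 2) ^ l)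

theorem NetSeq.approxSeq {d L : ℕ} (l : ℕ) {F : ℕ → (Fin d → ℝ) → ℝ} (hF : NetSeq d L F)
    (h : ∀ n, 1 ≤ n → ∀ x ∈ cube d, |F n x| ≤ 1) : ApproxSeq d L l F :=
  ⟨F, hF, h, 0, le_rfl, fun n _ x _ => by simp⟩

theorem abs_clip_sub_le {a b : ℝ} (hb : |b| ≤ 1) : |max (-1) (min 1 a) - b| ≤ |a - b| := by
  rw [abs_le] at hb
  rcases le_total a 1 with h | h
  · rw [min_eq_right h]
    rcases le_total a (-1) with h' | h'
    · rw [max_eq_left h', abs_of_nonpos (by linarith), abs_of_nonpos (by linarith)]; linarith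
    · rw [max_eq_right h']
  · rw [min_eq_left h, max_eq_right (by norm_num), abs_of_nonneg (by linarith),
      abs_of_nonneg (by linarith)]
    linarith

theorem abs_clip_le (a : ℝ) : |max (-1) (min 1 a)| ≤ 1 :=
  abs_le.2 ⟨le_max_left _ _, max_le (by norm_num) (min_le_left _ _)⟩

namespace ApproxSeq

variable {d L l : ℕ}

theorem mono {L' : ℕ} (h : L ≤ L') {f : ℕ → (Fin d → ℝ) → ℝ} (hf : ApproxSeq d L l f) :
    ApproxSeq d L' l f := by
  obtain ⟨F, hF, h1, h2⟩ := hf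
  exact ⟨F, hF.mono h, h1, h2⟩

theorem mul {f g : ℕ → (Fin d → ℝ) → ℝ} (hf : ApproxSeq d L l f) (hg : ApproxSeq d L l g)
    (hg1 : ∀ n, 1 ≤ n → ∀ x ∈ cube d, |g n x| ≤ 1) :
    ApproxSeq d (L + (2 * l + 7)) l (fun n x => f n x * g n x) := by
  obtain ⟨F, hF, hF1, C, hC, hFC⟩ := hf
  obtain ⟨G, hG, hG1, C', hC', hGC⟩ := hg
  have hu : ∀ σ : ℝ, NetSeq d (L + 3) (fun n x => |1 / 2 * F n x + σ * G n x|) := fun σ => by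
    have := (NetSeq.linComb_const (ι := Bool) (F := fun b => if b then F else G)
      (fun b => by cases b <;> simpa) (fun b => if b then 1 / 2 else σ)).abs
    simpa using this
  have hp := fun σ => (hu σ).parabolaApprox l
  have hu' : ∀ σ, NetSeq d (L + 3 + 2 * l + 1) (fun n x => |1 / 2 * F n x + σ * G n x|) :=
    fun σ => (hu σ).mono (by omega)
  have hgate := ((NetSeq.linComb_const (ι := Bool × Bool) (F := fun p n x =>
      if p.2 then |1 / 2 * F n x + (if p.1 then 1 / 2 else -1 / 2) * G n x| else
        parabolaApprox n l |1 / 2 * F n x + (if p.1 then 1 / 2 else -1 / 2) * G n x|)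
      (fun p => by rcases p with ⟨b, _ | _⟩; exacts [hp _, hu' _])
      (fun p => (if p.1 then 1 else -1) * (if p.2 then 1 else -1)))).clip
  refine ⟨_, hgate.mono (by omega), fun n _ x _ => abs_clip_le _, 2 + C + C', by positivity,
    fun n hn x hx => ?_⟩
  have hf' := abs_le.1 (hF1 n hn x hx)
  have hg' := abs_le.1 (hG1 n hn x hx)
  have hFG : |F n x * G n x| ≤ 1 := by
    rw [abs_mul]; exact mul_le_one₀ (hF1 n hn x hx) (abs_nonneg _) (hG1 n hn x hx)
  have hε : 0 ≤ 1 / ((n : ℝ) ^ 2) ^ l := by positivity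
  set ε := 1 / ((n : ℝ) ^ 2) ^ l
  have hplus := parabolaApprox_spec hn l (abs_nonneg (1 / 2 * F n x + 1 / 2 * G n x))
    (abs_le.2 ⟨by linarith, by linarith⟩)
  have hminus := parabolaApprox_spec hn l (abs_nonneg (1 / 2 * F n x + -1 / 2 * G n x))
    (abs_le.2 ⟨by linarith, by linarith⟩)
  have h1 : |(∑ p : Bool × Bool, (if p.1 then 1 else -1) * (if p.2 then 1 else -1) *
      (if p.2 then |1 / 2 * F n x + (if p.1 then 1 / 2 else -1 / 2) * G n x| else
        parabolaApprox n l |1 / 2 * F n x + (if p.1 then 1 / 2 else -1 / 2) * G n x|)) -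
      F n x * G n x| ≤ 2 * ε := by
    simp only [Fintype.sum_prod_type, Fintype.sum_bool, if_true, Bool.false_eq_true, if_false,
      one_mul, mul_one]
    have e1 := sq_abs (1 / 2 * F n x + 1 / 2 * G n x)
    have e2 := sq_abs (1 / 2 * F n x + -1 / 2 * G n x)
    rw [abs_le] at hplus hminus ⊢
    constructor <;> nlinarith
  have h2 : |F n x * G n x - f n x * g n x| ≤ (C + C') * ε := by
    have : F n x * G n x - f n x * g n x
        = F n x * (G n x - g n x) + (F n x - f n x) * g n x := by ring
    rw [this]
    refine (abs_add_le _ _).trans ?_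
    rw [abs_mul, abs_mul]
    have a1 := mul_le_mul (hF1 n hn x hx) (hGC n hn x hx) (abs_nonneg _) zero_le_one
    have a2 := mul_le_mul (hFC n hn x hx) (hg1 n hn x hx) (abs_nonneg _) (by positivity)
    linarith
  calc _ ≤ _ := abs_sub_le _ (F n x * G n x) _
    _ ≤ 2 * ε + (C + C') * ε := add_le_add ((abs_clip_sub_le hFG).trans h1) h2
    _ = _ := by ring

theorem prod {m : ℕ} {f : Fin m → ℕ → (Fin d → ℝ) → ℝ} (hf : ∀ i, ApproxSeq d L l (f i))
    (h1 : ∀ i n, 1 ≤ n → ∀ x ∈ cube d, |f i n x| ≤ 1) :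
    ApproxSeq d (L + m * (2 * l + 7)) l (fun n x => ∏ i, f i n x) := by
  induction m with
  | zero =>
    have := ((NetSeq.const (d := d) 1).mono (Nat.zero_le L)).approxSeq l (by simp)
    simpa using this
  | succ m ih =>
    have := (ih (fun i => hf i.castSucc) (fun i => h1 _)).mul
      ((hf (Fin.last m)).mono (Nat.le_add_right _ _)) (h1 _)
    simp only [Fin.prod_univ_castSucc]
    exact this.mono (by rw [add_assoc, ← Nat.succ_mul])

end ApproxSeq

/-! ### Local polynomial approximation -/

/-- The monomial given by a word of length `s` in the letters `1, z 0, …, z (D - 1)`. -/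
def wordMonomial {D s : ℕ} (k : Fin s → Option (Fin D)) (z : Fin D → ℝ) : ℝ :=
  ∏ j, (k j).elim 1 z

/-- `p` is a polynomial of degree at most `s` with coefficients bounded by `B`. -/
def PolyBound {D : ℕ} (s : ℕ) (B : ℝ) (p : (Fin D → ℝ) → ℝ) : Prop :=
  ∃ c : (Fin s → Option (Fin D)) → ℝ, (∀ k, |c k| ≤ B) ∧
    ∀ z, p z = ∑ k, c k * wordMonomial k z

/-- `G` is approximated up to order `r` by polynomials of degree at most `s` with bounded
coefficients around each point of `Ω`. -/
def LocallyPoly {D : ℕ} (s : ℕ) (r : ℝ) (G : (Fin D → ℝ) → ℝ) (Ω : Set (Fin D → ℝ)) : Prop :=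
  ∃ C : ℝ, 0 ≤ C ∧ ∀ z₀ ∈ Ω, ∃ p, PolyBound s C p ∧ ∀ z ∈ Ω, |G z - p z| ≤ C * ‖z - z₀‖ ^ r

theorem abs_elim_le {D : ℕ} {z : Fin D → ℝ} (hz : z ∈ cube D) (o : Option (Fin D)) :
    |o.elim 1 z| ≤ 1 := by
  cases o
  · simp
  · exact hz _

theorem abs_wordMonomial_le {D s : ℕ} (k : Fin s → Option (Fin D)) {z : Fin D → ℝ}
    (hz : z ∈ cube D) : |wordMonomial k z| ≤ 1 := by
  rw [wordMonomial, Finset.abs_prod]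
  exact Finset.prod_le_one (fun _ _ => abs_nonneg _) fun _ _ => abs_elim_le hz _

namespace PolyBound

variable {D s : ℕ} {B : ℝ} {p : (Fin D → ℝ) → ℝ}

theorem mono {B' : ℝ} (hB : B ≤ B') (hp : PolyBound s B p) : PolyBound s B' p := by
  obtain ⟨c, hc, h⟩ := hp
  exact ⟨c, fun k => (hc k).trans hB, h⟩

theorem const_mul (a : ℝ) (hp : PolyBound s B p) :
    PolyBound s (|a| * B) (fun z => a * p z) := by
  obtain ⟨c, hc, h⟩ := hp
  refine ⟨fun k => a * c k, fun k => ?_, fun z => ?_⟩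
  · rw [abs_mul]
    exact mul_le_mul_of_nonneg_left (hc k) (abs_nonneg _)
  · simp only [h, Finset.mul_sum, mul_assoc]

theorem sum {ι : Type*} (t : Finset ι) {B : ι → ℝ} {p : ι → (Fin D → ℝ) → ℝ}
    (hp : ∀ i ∈ t, PolyBound s (B i) (p i)) :
    PolyBound s (∑ i ∈ t, B i) (fun z => ∑ i ∈ t, p i z) := by
  choose! c hc h using hp
  refine ⟨fun k => ∑ i ∈ t, c i k, fun k => (Finset.abs_sum_le_sum_abs _ _).trans
    (Finset.sum_le_sum fun i hi => hc i hi k), fun z => ?_⟩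
  simp only [Finset.sum_mul]
  rw [Finset.sum_comm]
  exact Finset.sum_congr rfl fun i hi => h i hi z

theorem affine_mul {A : ℝ} {a : Option (Fin D) → ℝ} (ha : ∀ o, |a o| ≤ A)
    (hp : PolyBound s B p) :
    PolyBound (s + 1) (A * B) (fun z => (∑ o, a o * o.elim 1 z) * p z) := by
  obtain ⟨c, hc, h⟩ := hp
  refine ⟨fun k => a (k 0) * c (Fin.tail k), fun k => ?_, fun z => ?_⟩
  · rw [abs_mul]
    exact mul_le_mul (ha _) (hc _) (abs_nonneg _) ((abs_nonneg _).trans (ha none))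
  · dsimp only
    rw [← (Fin.consEquiv fun _ => Option (Fin D)).sum_comp, Fintype.sum_prod_type, h,
      Finset.sum_mul]
    refine Finset.sum_congr rfl fun o _ => ?_
    rw [Finset.mul_sum]
    refine Finset.sum_congr rfl fun k _ => ?_
    simp [Fin.consEquiv, wordMonomial, Fin.prod_univ_succ]
    ring

theorem succ (hp : PolyBound s B p) : PolyBound (s + 1) B p := by
  have := hp.affine_mul (A := 1) (a := fun o => if o = none then 1 else 0)
    (fun o => by split_ifs <;> simp)
  simpa [Fintype.sum_option] using this

theorem of_le {s' : ℕ} (hs : s ≤ s') (hp : PolyBound s B p) : PolyBound s' B p := by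
  induction hs with
  | refl => exact hp
  | step _ ih => exact ih.succ

theorem prod_sub {A : ℝ} (hA : 1 ≤ A) {z₀ : Fin D → ℝ} (hz : ∀ i, |z₀ i| ≤ A) {j : ℕ}
    (k : Fin j → Fin D) : PolyBound j (A ^ j) (fun z => ∏ i, (z (k i) - z₀ (k i))) := by
  induction j with
  | zero => exact ⟨fun _ => 1, by simp, by simp [wordMonomial]⟩
  | succ j ih =>
    have := (ih (fun i => k i.succ)).affine_mul (A := A)
      (a := fun o => o.elim (-z₀ (k 0)) fun i => if i = k 0 then 1 else 0) (fun o => ?_)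
    · rw [pow_succ']
      convert this using 2 with z
      rw [Fin.prod_univ_succ, Fintype.sum_option]
      simp
      left; ring
    · cases o
      · simpa using hz _
      · simp only [Option.elim]
        split_ifs <;> simp <;> linarith

theorem multilinear {A M : ℝ} (hA : 1 ≤ A) {z₀ : Fin D → ℝ} (hz : ∀ i, |z₀ i| ≤ A) {j : ℕ}
    {T : ContinuousMultilinearMap ℝ (fun _ : Fin j => Fin D → ℝ) ℝ} (hT : ‖T‖ ≤ M) :
    PolyBound j (D ^ j * (M * A ^ j)) (fun z => T fun _ => z - z₀) := by
  have hM : ∀ k : Fin j → Fin D, |T fun i => Pi.single (k i) 1| ≤ M := fun k => by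
    refine (T.le_opNorm _).trans ?_
    simpa [Pi.norm_single] using hT
  have := sum (s := j) (Finset.univ : Finset (Fin j → Fin D)) (B := fun _ => M * A ^ j)
    (p := fun k z => (T fun i => Pi.single (k i) 1) * ∏ i, (z (k i) - z₀ (k i)))
    (fun k _ => ((prod_sub hA hz k).const_mul _).mono
      (mul_le_mul_of_nonneg_right (hM k) (by positivity)))
  convert this using 2 with z
  · simp
  · have h : z - z₀ = ∑ i, (z i - z₀ i) • (Pi.single i 1 : Fin D → ℝ) :=
      pi_eq_sum_univ' (z - z₀)
    rw [h, T.map_sum]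
    refine Finset.sum_congr rfl fun k _ => ?_
    rw [T.map_smul_univ, smul_eq_mul, mul_comm]

theorem abs_le (hp : PolyBound s B p) {z : Fin D → ℝ} (hz : z ∈ cube D) :
    |p z| ≤ (D + 1) ^ s * B := by
  obtain ⟨c, hc, h⟩ := hp
  rw [h]
  refine (Finset.abs_sum_le_sum_abs _ _).trans ((Finset.sum_le_card_nsmul _ _ B fun k _ => ?_).trans
    (by simp))
  rw [abs_mul]
  have := mul_le_mul (hc k) (abs_wordMonomial_le k hz) (abs_nonneg _)
    ((abs_nonneg _).trans (hc k))
  simpa using this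

end PolyBound

/-! ### Taylor expansions -/

theorem abs_sub_taylorSum_le {K : ℝ} (s : ℕ) (ψ : ℕ → ℝ → ℝ)
    (hd : ∀ j < s, ∀ t ∈ Set.Icc (0 : ℝ) 1,
      HasDerivWithinAt (ψ j) (ψ (j + 1) t) (Set.Icc 0 1) t)
    (hK : ∀ t ∈ Set.Icc (0 : ℝ) 1, |ψ s t - ψ s 0| ≤ K) :
    ∀ t ∈ Set.Icc (0 : ℝ) 1,
      |ψ 0 t - ∑ j ∈ Finset.range (s + 1), 1 / (j.factorial : ℝ) * (ψ j 0 * t ^ j)| ≤ K := by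
  induction s generalizing ψ with
  | zero => simpa using hK
  | succ s ih =>
    intro t ht
    have hK0 : 0 ≤ K := (abs_nonneg _).trans (hK t ht)
    have hR : ∀ t ∈ Set.Icc (0 : ℝ) 1, HasDerivWithinAt (fun t => ψ 0 t -
        ∑ j ∈ Finset.range (s + 1 + 1), 1 / (j.factorial : ℝ) * (ψ j 0 * t ^ j))
        (ψ 1 t - ∑ j ∈ Finset.range (s + 1), 1 / (j.factorial : ℝ) * (ψ (j + 1) 0 * t ^ j))
        (Set.Icc 0 1) t := fun t ht => by
      refine (hd 0 (Nat.succ_pos s) t ht).sub ?_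
      simp only [Finset.sum_range_succ' _ (s + 1)]
      have hsum : HasDerivWithinAt (fun t : ℝ => ∑ j ∈ Finset.range (s + 1),
          1 / ((j + 1).factorial : ℝ) * (ψ (j + 1) 0 * t ^ (j + 1)))
          (∑ j ∈ Finset.range (s + 1), 1 / (j.factorial : ℝ) * (ψ (j + 1) 0 * t ^ j))
          (Set.Icc 0 1) t := HasDerivWithinAt.fun_sum fun j _ => by
        have := (((hasDerivAt_pow (j + 1) t).const_mul (ψ (j + 1) 0)).const_mul
          (1 / ((j + 1).factorial : ℝ))).hasDerivWithinAt (s := Set.Icc (0 : ℝ) 1)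
        convert this using 1
        rw [Nat.factorial_succ]
        have : (j.factorial : ℝ) ≠ 0 := by exact_mod_cast j.factorial_ne_zero
        push_cast
        field_simp
      simpa using hsum.add_const (ψ 0 0)
    have := (convex_Icc (0 : ℝ) 1).norm_image_sub_le_of_norm_hasDerivWithin_le hR
      (fun t ht => ih (fun j => ψ (j + 1)) (fun j hj => hd (j + 1) (by omega)) hK t ht)
      (Set.left_mem_Icc.2 zero_le_one) ht
    simp only [Real.norm_eq_abs, sub_zero] at this
    have h0 : ψ 0 0 - ∑ j ∈ Finset.range (s + 1 + 1),
        1 / (j.factorial : ℝ) * (ψ j 0 * (0 : ℝ) ^ j) = 0 := by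
      rw [Finset.sum_range_succ']
      simp
    rw [h0, sub_zero] at this
    refine this.trans (mul_le_of_le_one_right hK0 ?_)
    rw [abs_of_nonneg ht.1]
    exact ht.2

theorem abs_sub_taylorPoly_le {E : Type*} [NormedAddCommGroup E] [NormedSpace ℝ E] {s : ℕ}
    {v M : ℝ} (hv : 0 < v) (hM : 0 ≤ M) {f : E → ℝ} {Ω : Set E} (hf : ContDiffOn ℝ s f Ω)
    (hΩ : Convex ℝ Ω) (hu : UniqueDiffOn ℝ Ω)
    (hH : ∀ z ∈ Ω, ∀ z₀ ∈ Ω, ‖iteratedFDerivWithin ℝ s f Ω z - iteratedFDerivWithin ℝ s f Ω z₀‖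
      ≤ M * ‖z - z₀‖ ^ v) {z z₀ : E} (hz : z ∈ Ω) (hz₀ : z₀ ∈ Ω) :
    |f z - ∑ j ∈ Finset.range (s + 1), 1 / (j.factorial : ℝ) *
      iteratedFDerivWithin ℝ j f Ω z₀ (fun _ => z - z₀)| ≤ M * ‖z - z₀‖ ^ ((s : ℝ) + v) := by
  set h := z - z₀ with hh
  have hmem : ∀ t ∈ Set.Icc (0 : ℝ) 1, z₀ + t • h ∈ Ω := fun t ht =>
    hΩ.add_smul_sub_mem hz₀ hz ht
  have key := abs_sub_taylorSum_le (K := M * ‖h‖ ^ ((s : ℝ) + v)) s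
    (fun j t => iteratedFDerivWithin ℝ j f Ω (z₀ + t • h) (fun _ => h)) ?_ ?_ 1
    (Set.right_mem_Icc.2 zero_le_one)
  · simpa [hh] using key
  · intro j hj t ht
    have h1 := (hf.differentiableOn_iteratedFDerivWithin (by exact_mod_cast hj) hu
      (z₀ + t • h) (hmem t ht)).hasFDerivWithinAt
    have h2 : HasDerivWithinAt (fun t : ℝ => z₀ + t • h) h (Set.Icc 0 1) t := by
      simpa using (((hasDerivAt_id t).smul_const h).const_add z₀).hasDerivWithinAt
    have h3 := (ContinuousMultilinearMap.apply ℝ (fun _ : Fin j => E) ℝ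
      (fun _ => h)).hasFDerivAt.comp_hasDerivWithinAt t (h1.comp_hasDerivWithinAt t h2 hmem)
    exact h3
  · intro t ht
    have hth : ‖z₀ + t • h - z₀‖ ≤ ‖h‖ := by
      rw [add_sub_cancel_left, norm_smul, Real.norm_eq_abs, abs_of_nonneg ht.1]
      exact mul_le_of_le_one_left (norm_nonneg _) ht.2
    simp only [zero_smul, add_zero]
    rw [← sub_apply]
    refine ((iteratedFDerivWithin ℝ s f Ω (z₀ + t • h) -
      iteratedFDerivWithin ℝ s f Ω z₀).le_opNorm fun _ => h).trans ?_
    simp only [Finset.prod_const, Finset.card_univ, Fintype.card_fin]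
    have h4 := (hH _ (hmem t ht) z₀ hz₀).trans (mul_le_mul_of_nonneg_left
      (Real.rpow_le_rpow (norm_nonneg _) hth hv.le) hM)
    refine (mul_le_mul_of_nonneg_right h4 (by positivity)).trans (le_of_eq ?_)
    rcases (norm_nonneg h).eq_or_lt with h0 | h0
    · rw [← h0, Real.zero_rpow hv.ne', Real.zero_rpow (by positivity)]
      simp
    · rw [Real.rpow_add h0, Real.rpow_natCast]
      ring

theorem LocallyPoly.of_hoelder {D s : ℕ} {v M : ℝ} (hv : 0 < v) (hM : 0 ≤ M)
    {f : (Fin D → ℝ) → ℝ} {Ω : Set (Fin D → ℝ)} (hf : ContDiffOn ℝ s f Ω) (hc : IsCompact Ω)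
    (hΩ : Convex ℝ Ω) (hu : UniqueDiffOn ℝ Ω)
    (hH : ∀ z ∈ Ω, ∀ z₀ ∈ Ω, ‖iteratedFDerivWithin ℝ s f Ω z - iteratedFDerivWithin ℝ s f Ω z₀‖
      ≤ M * ‖z - z₀‖ ^ v) :
    LocallyPoly s (s + v) f Ω := by
  have hB : ∀ j : ℕ, ∃ B : ℝ, j ≤ s → ∀ z ∈ Ω, ‖iteratedFDerivWithin ℝ j f Ω z‖ ≤ B := fun j => by
    by_cases hj : j ≤ s
    · obtain ⟨B, hB⟩ := hc.exists_bound_of_continuousOn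
        (hf.continuousOn_iteratedFDerivWithin (by exact_mod_cast hj) hu)
      exact ⟨B, fun _ => hB⟩
    · exact ⟨0, fun h => absurd h hj⟩
  choose B hB using hB
  obtain ⟨A, hA⟩ := hc.isBounded.exists_norm_le
  set C := ∑ j ∈ Finset.range (s + 1), (D : ℝ) ^ j * (|B j| * (max A 1) ^ j) with hC
  have hC0 : 0 ≤ C := Finset.sum_nonneg fun j _ => by positivity
  refine ⟨M + C, by positivity, fun z₀ hz₀ => ⟨_, (PolyBound.sum (Finset.range (s + 1))
    (B := fun j => (D : ℝ) ^ j * (|B j| * (max A 1) ^ j)) (fun j hj => ?_)).mono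
      (by linarith), fun z hz => (abs_sub_taylorPoly_le hv hM hf hΩ hu hH hz hz₀).trans ?_⟩⟩
  · have hj : j ≤ s := Nat.lt_succ_iff.1 (Finset.mem_range.1 hj)
    refine (((PolyBound.multilinear (le_max_right A 1)
      (fun i => (norm_le_pi_norm z₀ i).trans ((hA z₀ hz₀).trans (le_max_left _ _)))
      ((hB j hj z₀ hz₀).trans (le_abs_self _))).const_mul _).of_le hj).mono ?_
    refine mul_le_of_le_one_left (by positivity) ?_
    rw [abs_of_nonneg (by positivity), div_le_one (by positivity)]
    exact_mod_cast j.factorial_pos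
  · exact mul_le_mul_of_nonneg_right (by linarith) (by positivity)

theorem LocallyPoly.of_contDiffOn {D s : ℕ} {v : ℝ} (hv : 0 < v) (hv1 : v ≤ 1)
    {f : (Fin D → ℝ) → ℝ} {Ω : Set (Fin D → ℝ)} (hf : ContDiffOn ℝ (s + 1) f Ω)
    (hc : IsCompact Ω) (hΩ : Convex ℝ Ω) (hu : UniqueDiffOn ℝ Ω) :
    LocallyPoly s (s + v) f Ω := by
  have h1 : ContDiffOn ℝ 1 (iteratedFDerivWithin ℝ s f Ω) Ω := fun z hz =>
    (hf z hz).iteratedFDerivWithin_right hu (by rw [add_comm]) hz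
  obtain ⟨K, hK⟩ := h1.exists_lipschitzOnWith one_ne_zero hΩ hc
  obtain ⟨A, hA⟩ := hc.isBounded.exists_norm_le
  refine of_hoelder (M := K * (2 * |A|) ^ (1 - v)) hv (by positivity)
    (hf.of_le (by exact_mod_cast Nat.le_succ s)) hc hΩ hu fun z hz z₀ hz₀ => ?_
  have h2 : ‖z - z₀‖ ≤ 2 * |A| := (norm_sub_le _ _).trans
    (by linarith [hA z hz, hA z₀ hz₀, le_abs_self A])
  refine (lipschitzOnWith_iff_norm_sub_le.1 hK hz hz₀).trans ?_
  rw [mul_assoc]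
  refine mul_le_mul_of_nonneg_left ?_ K.2
  rcases (norm_nonneg (z - z₀)).eq_or_lt with h0 | h0
  · rw [← h0, Real.zero_rpow hv.ne', mul_zero]
  · calc ‖z - z₀‖ = ‖z - z₀‖ ^ (1 - v) * ‖z - z₀‖ ^ v := by
          rw [← Real.rpow_add h0]; simp
      _ ≤ _ := mul_le_mul_of_nonneg_right
          (Real.rpow_le_rpow h0.le h2 (by linarith)) (by positivity)

namespace LocallyPoly

variable {D s : ℕ} {r : ℝ} {G : (Fin D → ℝ) → ℝ} {Ω : Set (Fin D → ℝ)}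

theorem congr {G' : (Fin D → ℝ) → ℝ} (hG : LocallyPoly s r G Ω) (h : Set.EqOn G' G Ω) :
    LocallyPoly s r G' Ω := by
  obtain ⟨C, hC, hG⟩ := hG
  refine ⟨C, hC, fun z₀ hz₀ => ?_⟩
  obtain ⟨p, hp, hGp⟩ := hG z₀ hz₀
  exact ⟨p, hp, fun z hz => by rw [h hz]; exact hGp z hz⟩

theorem of_lipSmooth {v c₀ : ℝ} (hv : 0 < v) (hc₀ : 0 < c₀) (hG : LipSmooth D s v c₀ G) :
    LocallyPoly s (s + v) G (cube D) := by
  obtain ⟨hG1, hG2⟩ := hG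
  have hcube : cube D = Set.Icc (fun _ => -1) (fun _ => 1) := by
    ext z
    simp [cube, abs_le, Pi.le_def, forall_and]
  have hu : UniqueDiffOn ℝ (cube D) := by
    rw [hcube, ← Set.pi_univ_Icc]
    exact UniqueDiffOn.univ_pi fun i => uniqueDiffOn_Icc (by norm_num)
  refine of_hoelder (M := D ^ s * (c₀ * (Real.sqrt D) ^ v)) hv (by positivity) hG1
    (hcube ▸ isCompact_Icc) (hcube ▸ convex_Icc _ _) hu fun z hz z₀ hz₀ => ?_
  have hnorm : enorm2 (z - z₀) ≤ Real.sqrt D * ‖z - z₀‖ := by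
    rw [enorm2, ← Real.sqrt_sq (norm_nonneg (z - z₀)), ← Real.sqrt_mul (Nat.cast_nonneg D)]
    refine Real.sqrt_le_sqrt ((Finset.sum_le_card_nsmul _ _ (‖z - z₀‖ ^ 2) fun i _ => ?_).trans
      (by simp))
    rw [← sq_abs]
    exact pow_le_pow_left₀ (abs_nonneg _) (norm_le_pi_norm (z - z₀) i) 2
  have hk : ∀ k : Fin s → Fin D, |(iteratedFDerivWithin ℝ s G (cube D) z -
      iteratedFDerivWithin ℝ s G (cube D) z₀) (fun j => Pi.single (k j) 1)| ≤
      c₀ * (Real.sqrt D) ^ v * ‖z - z₀‖ ^ v := fun k => by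
    rw [sub_apply, mul_assoc, ← Real.mul_rpow (Real.sqrt_nonneg _) (norm_nonneg _)]
    exact (hG2 k z hz z₀ hz₀).trans (mul_le_mul_of_nonneg_left
      (Real.rpow_le_rpow (Real.sqrt_nonneg _) hnorm hv.le) hc₀.le)
  generalize iteratedFDerivWithin ℝ s G (cube D) z - iteratedFDerivWithin ℝ s G (cube D) z₀ = T
    at hk
  refine T.opNorm_le_bound (by positivity) fun m => ?_
  have hm : m = fun i => ∑ j, m i j • (Pi.single j 1 : Fin D → ℝ) :=
    funext fun i => pi_eq_sum_univ' (m i)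
  conv_lhs => rw [hm, T.map_sum]
  refine (norm_sum_le _ _).trans ((Finset.sum_le_card_nsmul _ _
    (c₀ * (Real.sqrt D) ^ v * ‖z - z₀‖ ^ v * ∏ i, ‖m i‖) fun k _ => ?_).trans (le_of_eq ?_))
  · rw [T.map_smul_univ, norm_smul, mul_comm, norm_prod]
    exact mul_le_mul (hk k) (Finset.prod_le_prod (fun _ _ => norm_nonneg _)
      fun i _ => norm_le_pi_norm (m i) _) (by positivity) (by positivity)
  · simp
    ring

theorem comp {m : ℕ} {v : ℝ} (hv : 0 < v) (hv1 : v ≤ 1) {F : (Fin m → ℝ) → ℝ}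
    {A : Set (Fin m → ℝ)} (hF : LocallyPoly s (s + v) F A) {Φ : (Fin D → ℝ) → Fin m → ℝ}
    (hΦ : ∀ i, ContDiffOn ℝ (s + 1) (fun z => Φ z i) Ω) (hmaps : Set.MapsTo Φ Ω A)
    (hc : IsCompact Ω) (hΩ : Convex ℝ Ω) (hu : UniqueDiffOn ℝ Ω) :
    LocallyPoly s (s + v) (fun z => F (Φ z)) Ω := by
  obtain ⟨C, hC, hF⟩ := hF
  have hword : ∀ k : Fin s → Option (Fin m),
      LocallyPoly s (s + v) (fun z => wordMonomial k (Φ z)) Ω := fun k => by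
    refine of_contDiffOn hv hv1 (contDiffOn_prod fun j _ => ?_) hc hΩ hu
    cases k j
    · exact contDiffOn_const
    · exact hΦ _
  choose B hB hword using hword
  obtain ⟨K, hK⟩ := (contDiffOn_pi.2 hΦ).exists_lipschitzOnWith (by positivity) hΩ hc
  refine ⟨C * K ^ ((s : ℝ) + v) + ∑ k, C * B k,
    add_nonneg (by positivity) (Finset.sum_nonneg fun k _ => mul_nonneg hC (hB k)),
    fun z₀ hz₀ => ?_⟩
  obtain ⟨p, ⟨c, hcC, hp⟩, hFp⟩ := hF _ (hmaps hz₀)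
  choose q hq hq' using fun k => hword k z₀ hz₀
  refine ⟨fun z => ∑ k, c k * q k z, (PolyBound.sum _ fun k _ => ((hq k).const_mul (c k)).mono
    (mul_le_mul_of_nonneg_right (hcC k) (hB k))).mono (by simpa using by positivity),
    fun z hz => ?_⟩
  have h1 : |F (Φ z) - p (Φ z)| ≤ C * K ^ ((s : ℝ) + v) * ‖z - z₀‖ ^ ((s : ℝ) + v) := by
    rw [mul_assoc, ← Real.mul_rpow K.coe_nonneg (norm_nonneg _)]
    exact (hFp _ (hmaps hz)).trans (mul_le_mul_of_nonneg_left (Real.rpow_le_rpow (norm_nonneg _)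
      (lipschitzOnWith_iff_norm_sub_le.1 hK hz hz₀) (by positivity)) hC)
  have h2 : |p (Φ z) - ∑ k, c k * q k z| ≤ (∑ k, C * B k) * ‖z - z₀‖ ^ ((s : ℝ) + v) := by
    rw [hp, ← Finset.sum_sub_distrib, Finset.sum_mul]
    refine (Finset.abs_sum_le_sum_abs _ _).trans (Finset.sum_le_sum fun k _ => ?_)
    rw [← mul_sub, abs_mul, mul_assoc]
    exact mul_le_mul (hcC k) (hq' k z hz) (abs_nonneg _) hC
  calc _ ≤ _ := abs_sub_le _ (p (Φ z)) _
    _ ≤ _ := add_le_add h1 h2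
    _ = _ := by ring

theorem abs_le_of_mem (hr : 0 < r) {C : ℝ} {z : Fin D → ℝ} {p : (Fin D → ℝ) → ℝ}
    (hz : z ∈ cube D) (hp : PolyBound s C p) (h : |G z - p z| ≤ C * ‖z - z‖ ^ r) :
    |G z| ≤ (D + 1) ^ s * C := by
  rw [sub_self, norm_zero, Real.zero_rpow hr.ne', mul_zero] at h
  rw [sub_eq_zero.1 (abs_nonpos_iff.1 h)]
  exact hp.abs_le hz

theorem of_local (hr : 0 < r) (hΩ : Ω ⊆ cube D) {C η : ℝ} (hC : 0 ≤ C) (hη : 0 < η)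
    (h : ∀ z₀ ∈ Ω, ∃ p, PolyBound s C p ∧
      ∀ z ∈ Ω, ‖z - z₀‖ < η → |G z - p z| ≤ C * ‖z - z₀‖ ^ r) :
    LocallyPoly s r G Ω := by
  set P := (D + 1) ^ s * C
  have hP : 0 ≤ P := by positivity
  refine ⟨C + 2 * P / η ^ r, by positivity, fun z₀ hz₀ => ?_⟩
  obtain ⟨p, hp, hGp⟩ := h z₀ hz₀
  refine ⟨p, hp.mono (le_add_of_nonneg_right (by positivity)), fun z hz => ?_⟩
  rcases lt_or_ge ‖z - z₀‖ η with hlt | hge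
  · exact (hGp z hz hlt).trans (mul_le_mul_of_nonneg_right
      (le_add_of_nonneg_right (by positivity)) (by positivity))
  · obtain ⟨q, hq, hGq⟩ := h z hz
    have h1 := abs_le_of_mem hr (hΩ hz) hq (hGq z hz (by simpa using hη))
    have h2 := hp.abs_le (hΩ hz)
    have h3 : η ^ r ≤ ‖z - z₀‖ ^ r := Real.rpow_le_rpow hη.le hge hr.le
    calc |G z - p z| ≤ |G z| + |p z| := abs_sub _ _
      _ ≤ 2 * P := by linarith
      _ = 2 * P / η ^ r * η ^ r := by field_simp
      _ ≤ 2 * P / η ^ r * ‖z - z₀‖ ^ r := by gcongr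
      _ ≤ _ := mul_le_mul_of_nonneg_right (by linarith) (by positivity)

end LocallyPoly

theorem abs_wordMonomial_sub_le {D s : ℕ} (k : Fin s → Option (Fin D)) {z w : Fin D → ℝ}
    (hz : z ∈ cube D) (hw : w ∈ cube D) :
    |wordMonomial k z - wordMonomial k w| ≤ s * ‖z - w‖ := by
  induction s with
  | zero => simp [wordMonomial]
  | succ s ih =>
    have ih := ih (fun i => k i.succ)
    have h0 : |(k 0).elim 1 z - (k 0).elim 1 w| ≤ ‖z - w‖ := by
      cases k 0
      · simp
      · exact norm_le_pi_norm (z - w) _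
    have hz' : wordMonomial k z = (k 0).elim 1 z * wordMonomial (fun i => k i.succ) z :=
      Fin.prod_univ_succ _
    have hw' : wordMonomial k w = (k 0).elim 1 w * wordMonomial (fun i => k i.succ) w :=
      Fin.prod_univ_succ _
    rw [hz', hw', show ∀ a b c e : ℝ, a * b - c * e = a * (b - e) + (a - c) * e by
      intros; ring]
    refine (abs_add_le _ _).trans ?_
    rw [abs_mul, abs_mul]
    have h1 := mul_le_mul (abs_elim_le hz (k 0)) ih (abs_nonneg _) zero_le_one
    have h2 := mul_le_mul h0 (abs_wordMonomial_le (fun i => k i.succ) hw) (abs_nonneg _)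
      (norm_nonneg _)
    push_cast
    linarith

theorem LocallyPoly.exists_modulus {D s : ℕ} {r : ℝ} (hr : 0 < r) {G : (Fin D → ℝ) → ℝ}
    {Ω : Set (Fin D → ℝ)} (hG : LocallyPoly s r G Ω) (hΩ : Ω ⊆ cube D) :
    ∃ C : ℝ, 0 ≤ C ∧ ∀ z ∈ Ω, ∀ w ∈ Ω, |G z - G w| ≤ C * (‖z - w‖ ^ r + ‖z - w‖) := by
  obtain ⟨C, hC, hG⟩ := hG
  refine ⟨C + (D + 1) ^ s * (C * s), by positivity, fun z hz w hw => ?_⟩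
  obtain ⟨p, ⟨c, hcC, hp⟩, hGp⟩ := hG w hw
  have h1 := hGp z hz
  have h2 := hGp w hw
  rw [sub_self, norm_zero, Real.zero_rpow hr.ne', mul_zero] at h2
  rw [sub_eq_zero.1 (abs_nonpos_iff.1 h2)]
  have h3 : |p z - p w| ≤ (D + 1) ^ s * (C * s) * ‖z - w‖ := by
    rw [hp, hp, ← Finset.sum_sub_distrib]
    refine (Finset.abs_sum_le_sum_abs _ _).trans ((Finset.sum_le_card_nsmul _ _
      (C * (s * ‖z - w‖)) fun k _ => ?_).trans (le_of_eq ?_))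
    · rw [← mul_sub, abs_mul]
      exact mul_le_mul (hcC k) (abs_wordMonomial_sub_le k (hΩ hz) (hΩ hw)) (abs_nonneg _) hC
    · simp [mul_assoc]
  have h4 : 0 ≤ (D + 1) ^ s * (C * s) * ‖z - w‖ ^ r := by positivity
  have h5 : 0 ≤ C * ‖z - w‖ := by positivity
  calc _ ≤ _ := abs_sub_le _ (p z) _
    _ ≤ _ := add_le_add h1 h3
    _ ≤ _ := by linarith

/-! ### The partially radial function as a function of its features -/

/-- The features of a partially radial function: the mean of the squares of the first `d'`
coordinates, and the remaining coordinates. -/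
def radialFeature (d d' : ℕ) (x : Fin d → ℝ) (k : Fin (d - d' + 1)) : ℝ :=
  if (k : ℕ) = 0 then 1 / d' * ∑ i ∈ Finset.range d', (extendZ x i) ^ 2
  else extendZ x (d' + (k : ℕ) - 1)

/-- The range of the features: `[a, b]` in the zeroth coordinate, `[-1, 1]` in the others. -/
def featureBox (m : ℕ) (a b : ℝ) : Set (Fin (m + 1) → ℝ) :=
  Set.Icc (fun k => if (k : ℕ) = 0 then a else -1) (fun k => if (k : ℕ) = 0 then b else 1)

theorem mem_featureBox {m : ℕ} {a b : ℝ} {z : Fin (m + 1) → ℝ} :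
    z ∈ featureBox m a b ↔ (a ≤ z 0 ∧ z 0 ≤ b) ∧ ∀ k : Fin m, |z k.succ| ≤ 1 := by
  simp only [featureBox, Set.mem_Icc, Pi.le_def, Fin.forall_fin_succ]
  simp only [Fin.val_zero, if_true, Fin.val_succ, Nat.succ_ne_zero, if_false, abs_le, forall_and]
  tauto

theorem isCompact_featureBox (m : ℕ) (a b : ℝ) : IsCompact (featureBox m a b) := isCompact_Icc

theorem convex_featureBox (m : ℕ) (a b : ℝ) : Convex ℝ (featureBox m a b) := convex_Icc _ _

theorem uniqueDiffOn_featureBox (m : ℕ) {a b : ℝ} (h : a < b) :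
    UniqueDiffOn ℝ (featureBox m a b) := by
  rw [featureBox, ← Set.pi_univ_Icc]
  refine UniqueDiffOn.univ_pi fun k => ?_
  split_ifs
  · exact uniqueDiffOn_Icc h
  · exact uniqueDiffOn_Icc (by norm_num)

theorem featureBox_subset_cube (m : ℕ) {a b : ℝ} (ha : -1 ≤ a) (hb : b ≤ 1) :
    featureBox m a b ⊆ cube (m + 1) := fun z hz k => by
  rw [mem_featureBox] at hz
  refine Fin.cases (abs_le.2 ⟨by linarith, by linarith⟩) hz.2 k

theorem abs_extendZ_le {d : ℕ} {x : Fin d → ℝ} (hx : x ∈ cube d) (i : ℕ) : |extendZ x i| ≤ 1 := by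
  unfold extendZ
  split_ifs
  · exact hx _
  · simp

theorem radialFeature_mem {d d' : ℕ} (hd' : 0 < d') {x : Fin d → ℝ} (hx : x ∈ cube d) :
    radialFeature d d' x ∈ featureBox (d - d') 0 1 := by
  rw [mem_featureBox]
  refine ⟨⟨?_, ?_⟩, fun k => ?_⟩
  · simp only [radialFeature, Fin.val_zero, if_true]
    exact mul_nonneg (by positivity) (Finset.sum_nonneg fun i _ => sq_nonneg _)
  · simp only [radialFeature, Fin.val_zero, if_true]
    have := Finset.sum_le_card_nsmul (Finset.range d') (fun i => (extendZ x i) ^ 2) 1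
      fun i _ => (sq_le_one_iff_abs_le_one _).2 (abs_extendZ_le hx i)
    rw [one_div, inv_mul_le_iff₀ (by positivity)]
    simpa using this
  · simp only [radialFeature, Fin.val_succ, Nat.succ_ne_zero, if_false]
    exact abs_extendZ_le hx _

/-- Replacing the mean of squares by the radial feature `t_{d'}` of the statement. -/
def scaleFeature (d d' : ℕ) (z : Fin (d - d' + 1) → ℝ) (k : Fin (d - d' + 1)) : ℝ :=
  if (k : ℕ) = 0 then Real.sqrt d' * z 0 else z k

/-- A point of `ℝ^d` with given features. -/
def radialSection (d d' : ℕ) (z : Fin (d - d' + 1) → ℝ) (i : Fin d) : ℝ :=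
  if (i : ℕ) < d' then Real.sqrt (z 0) else extendZ z (i - d' + 1)

theorem radialSection_mem {d d' : ℕ} {a : ℝ} {z : Fin (d - d' + 1) → ℝ} (ha : 0 ≤ a)
    (hz : z ∈ featureBox (d - d') a 1) : radialSection d d' z ∈ cube d := fun i => by
  unfold radialSection
  split_ifs
  · rw [abs_of_nonneg (Real.sqrt_nonneg _)]
    exact Real.sqrt_le_one.2 (mem_featureBox.1 hz).1.2
  · exact abs_extendZ_le (featureBox_subset_cube _ (by linarith) le_rfl hz) _

section

variable {d d' s : ℕ} {v c₀ : ℝ} {fstar : (Fin d → ℝ) → ℝ} {g : (Fin (d - d' + 1) → ℝ) → ℝ}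

theorem rpow_neg_half_mul (t : ℝ) :
    (d' : ℝ) ^ (-(1 / 2 : ℝ)) * (d' * t) = Real.sqrt d' * t := by
  rcases (Nat.cast_nonneg (α := ℝ) d').eq_or_lt with h | h
  · simp [← h]
  · rw [Real.rpow_neg h.le, ← Real.sqrt_eq_rpow]
    nth_rewrite 2 [← Real.mul_self_sqrt h.le]
    have := (Real.sqrt_pos.2 h).ne'
    field_simp

theorem apply_eq_scaleFeature (hd' : 0 < d')
    (hpradial : ∀ x ∈ cube d,
      fstar x = g fun k =>
        if (k : ℕ) = 0 then
          (d' : ℝ) ^ (-(1 / 2 : ℝ)) * ∑ i ∈ Finset.range d', (extendZ x i) ^ 2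
        else extendZ x (d' + (k : ℕ) - 1)) {x : Fin d → ℝ} (hx : x ∈ cube d) :
    fstar x = g (scaleFeature d d' (radialFeature d d' x)) := by
  rw [hpradial x hx]
  congr 1
  funext k
  have hd : (d' : ℝ) ≠ 0 := by positivity
  simp only [scaleFeature, radialFeature, Fin.val_zero, if_true]
  split_ifs
  · rw [← rpow_neg_half_mul, ← mul_assoc (d' : ℝ), mul_one_div_cancel hd, one_mul]
  · rfl

theorem radialFeature_radialSection (hd' : 0 < d') (hdd : d' ≤ d) {z : Fin (d - d' + 1) → ℝ}
    (hz : 0 ≤ z 0) : radialFeature d d' (radialSection d d' z) = z := by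
  funext k
  have hd : (d' : ℝ) ≠ 0 := by positivity
  unfold radialFeature
  split_ifs with hk
  · rw [Finset.sum_congr rfl (g := fun _ => z 0) fun i hi => ?_]
    · obtain rfl : k = 0 := Fin.ext hk
      simp [hd]
    · rw [Finset.mem_range] at hi
      rw [extendZ, dif_pos (by omega), radialSection, if_pos (by simpa using hi),
        Real.sq_sqrt hz]
  · have h := k.2
    rw [extendZ, dif_pos (by omega), radialSection, if_neg (by simp; omega), extendZ,
      dif_pos (by simp; omega)]
    congr 1
    ext
    simp
    omega

theorem exists_locallyPoly_radial (hd' : 0 < d') (hdd : d' ≤ d) (hv : 0 < v) (hv1 : v ≤ 1)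
    (hc₀ : 0 < c₀) (hfstar : LipSmooth d s v c₀ fstar) (hg : LipSmooth (d - d' + 1) s v c₀ g)
    (hpradial : ∀ x ∈ cube d,
      fstar x = g fun k =>
        if (k : ℕ) = 0 then
          (d' : ℝ) ^ (-(1 / 2 : ℝ)) * ∑ i ∈ Finset.range d', (extendZ x i) ^ 2
        else extendZ x (d' + (k : ℕ) - 1)) :
    ∃ G, LocallyPoly s (s + v) G (featureBox (d - d') 0 1) ∧
      ∀ x ∈ cube d, fstar x = G (radialFeature d d' x) := by
  have hsection : ∀ z ∈ featureBox (d - d') 0 1,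
      fstar (radialSection d d' z) = g (scaleFeature d d' z) := fun z hz => by
    rw [apply_eq_scaleFeature hd' hpradial (radialSection_mem le_rfl hz),
      radialFeature_radialSection hd' hdd (mem_featureBox.1 hz).1.1]
  refine ⟨fun z => fstar (radialSection d d' z), ?_, fun x hx => ?_⟩
  swap
  · dsimp only
    rw [hsection _ (radialFeature_mem hd' hx), apply_eq_scaleFeature hd' hpradial hx]
  set q := Real.sqrt d'
  have hq : 1 ≤ q := Real.one_le_sqrt.2 (by exact_mod_cast hd')
  have hq1 : 1 / q ≤ 1 := by rw [div_le_one (by linarith)]; exact hq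
  have hq0 : 0 < 1 / q := by positivity
  have hA : LocallyPoly s (s + v) (fun z => fstar (radialSection d d' z))
      (featureBox (d - d') 0 (1 / q)) := by
    refine ((LocallyPoly.of_lipSmooth hv hc₀ hg).comp hv hv1 (Φ := scaleFeature d d')
      (fun k => ?_) (fun z hz k => ?_) (isCompact_featureBox _ _ _)
      (convex_featureBox _ _ _) (uniqueDiffOn_featureBox _ hq0)).congr fun z hz => hsection z ?_
    · unfold scaleFeature
      split_ifs <;> fun_prop
    · rw [mem_featureBox] at hz
      unfold scaleFeature
      split_ifs with hk
      · rw [abs_of_nonneg (mul_nonneg (by linarith) hz.1.1), ← le_div_iff₀' (by linarith)]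
        exact hz.1.2
      · obtain ⟨j, rfl⟩ := Fin.exists_succ_eq.2 (fun h => hk (by rw [h]; rfl) : k ≠ 0)
        exact hz.2 j
    · rw [mem_featureBox] at hz ⊢
      exact ⟨⟨hz.1.1, hz.1.2.trans hq1⟩, hz.2⟩
  have hB : LocallyPoly s (s + v) (fun z => fstar (radialSection d d' z))
      (featureBox (d - d') (1 / q / 2) 1) := by
    refine (LocallyPoly.of_lipSmooth hv hc₀ hfstar).comp hv hv1
      (fun i => ?_) (fun z hz => radialSection_mem (by linarith) hz) (isCompact_featureBox _ _ _)
      (convex_featureBox _ _ _) (uniqueDiffOn_featureBox _ (by linarith))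
    unfold radialSection
    split_ifs
    · refine ContDiffOn.sqrt (by fun_prop) fun z hz => ?_
      have := (mem_featureBox.1 hz).1.1
      linarith
    · unfold extendZ
      split_ifs
      · fun_prop
      · exact contDiffOn_const
  obtain ⟨C, hC, hA⟩ := hA
  obtain ⟨C', hC', hB⟩ := hB
  refine LocallyPoly.of_local (by positivity) (featureBox_subset_cube _ (by norm_num) le_rfl)
    (C := max C C') (η := 1 / q / 4) (le_max_of_le_left hC) (by linarith) fun z₀ hz₀ => ?_
  rw [mem_featureBox] at hz₀
  rcases le_total (z₀ 0) (1 / q * (3 / 4)) with h | h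
  · obtain ⟨p, hp, hGp⟩ := hA z₀ (mem_featureBox.2 ⟨⟨hz₀.1.1, by linarith⟩, hz₀.2⟩)
    refine ⟨p, hp.mono (le_max_left _ _), fun z hz hlt => (hGp z ?_).trans
      (mul_le_mul_of_nonneg_right (le_max_left _ _) (by positivity))⟩
    have := abs_lt.1 ((norm_le_pi_norm (z - z₀) 0).trans_lt hlt)
    rw [mem_featureBox] at hz ⊢
    rw [Pi.sub_apply] at this
    exact ⟨⟨hz.1.1, by linarith⟩, hz.2⟩
  · obtain ⟨p, hp, hGp⟩ := hB z₀ (mem_featureBox.2 ⟨⟨by linarith, hz₀.1.2⟩, hz₀.2⟩)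
    refine ⟨p, hp.mono (le_max_right _ _), fun z hz hlt => (hGp z ?_).trans
      (mul_le_mul_of_nonneg_right (le_max_right _ _) (by positivity))⟩
    have := abs_lt.1 ((norm_le_pi_norm (z - z₀) 0).trans_lt hlt)
    rw [mem_featureBox] at hz ⊢
    rw [Pi.sub_apply] at this
    exact ⟨⟨by linarith, hz.1.2⟩, hz.2⟩

end

/-! ### A coloured partition of unity -/

/-- The hat function supported in `[-1, 1]`. -/
def tent (t : ℝ) : ℝ := relu (t + 1) - 2 * relu t + relu (t - 1)

theorem tent_eq_zero {t : ℝ} (h : 1 ≤ |t|) : tent t = 0 := by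
  rcases le_abs.1 h with h | h
  · rw [tent, relu_of_nonneg (by linarith), relu_of_nonneg (by linarith),
      relu_of_nonneg (by linarith)]
    ring
  · rw [tent, relu_of_nonpos (by linarith), relu_of_nonpos (by linarith),
      relu_of_nonpos (by linarith)]
    ring

theorem tent_of_nonneg {t : ℝ} (h0 : 0 ≤ t) (h1 : t ≤ 1) : tent t = 1 - t := by
  rw [tent, relu_of_nonneg (by linarith), relu_of_nonneg h0, relu_of_nonpos (by linarith)]
  ring

theorem tent_of_nonpos {t : ℝ} (h0 : t ≤ 0) (h1 : -1 ≤ t) : tent t = 1 + t := by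
  rw [tent, relu_of_nonneg (by linarith), relu_of_nonpos h0, relu_of_nonpos (by linarith)]
  ring

theorem tent_nonneg (t : ℝ) : 0 ≤ tent t := by
  rcases le_or_gt 1 |t| with h | h
  · rw [tent_eq_zero h]
  · rw [abs_lt] at h
    rcases le_total 0 t with h0 | h0
    · rw [tent_of_nonneg h0 h.2.le]; linarith
    · rw [tent_of_nonpos h0 h.1.le]; linarith

theorem sum_tent {M : ℕ} (hM : 1 ≤ M) {u : ℝ} (h0 : 0 ≤ u) (h1 : u ≤ M) :
    ∑ m : Fin (M + 1), tent (u - (m : ℕ)) = 1 := by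
  obtain ⟨m, hm, hm0, hm1⟩ := exists_piece hM h0 h1
  rw [Fin.sum_univ_eq_sum_range (fun k => tent (u - (k : ℕ))) (M + 1),
    ← Finset.sum_subset (s₁ := {m, m + 1}), Finset.sum_pair (by omega),
    tent_of_nonneg (by linarith) (by linarith), tent_of_nonpos (by push_cast; linarith)
      (by push_cast; linarith)]
  · push_cast
    ring
  · intro k hk
    simp only [Finset.mem_insert, Finset.mem_singleton, Finset.mem_range] at hk ⊢
    omega
  · intro k _ hk
    simp only [Finset.mem_insert, Finset.mem_singleton, not_or] at hk
    refine tent_eq_zero ?_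
    rcases lt_or_gt_of_ne hk.1 with h | h
    · have : (k : ℝ) + 1 ≤ m := by exact_mod_cast h
      exact le_abs.2 (Or.inl (by linarith))
    · have : (m : ℝ) + 2 ≤ k := by exact_mod_cast (show m + 2 ≤ k by omega)
      exact le_abs.2 (Or.inr (by linarith))

/-- The sum of the hat functions at the nodes congruent to `q` modulo `3`. -/
def colorTent (M : ℕ) (q : Fin 3) (u : ℝ) : ℝ :=
  ∑ m : Fin (M + 1), if (m : ℕ) % 3 = q then tent (u - (m : ℕ)) else 0

theorem colorTent_mem {M : ℕ} (hM : 1 ≤ M) (q : Fin 3) {u : ℝ} (h0 : 0 ≤ u) (h1 : u ≤ M) :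
    |colorTent M q u| ≤ 1 := by
  rw [colorTent, abs_of_nonneg (Finset.sum_nonneg fun m _ => by
    split_ifs; exacts [tent_nonneg _, le_rfl]), ← sum_tent hM h0 h1]
  refine Finset.sum_le_sum fun m _ => ?_
  split_ifs
  exacts [le_rfl, tent_nonneg _]

section

variable {D M : ℕ}

/-- A cut-off function equal to `1` on the unit cell around the node `j` and vanishing where some
coordinate has distance at least `2` from that node. -/
def bump (j : Fin D → Fin (M + 1)) (u : Fin D → ℝ) : ℝ :=
  relu (1 - ∑ i, (relu (u i - (j i : ℕ) - 1) + relu (-u i + (j i : ℕ) - 1)))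

theorem bump_eq_one {j : Fin D → Fin (M + 1)} {u : Fin D → ℝ}
    (h : ∀ i, |u i - (j i : ℕ)| ≤ 1) : bump j u = 1 := by
  rw [bump, Finset.sum_eq_zero, sub_zero, relu_of_nonneg zero_le_one]
  intro i _
  have := abs_le.1 (h i)
  rw [relu_of_nonpos (by linarith), relu_of_nonpos (by linarith), add_zero]

theorem bump_eq_zero {j : Fin D → Fin (M + 1)} {u : Fin D → ℝ} {i : Fin D}
    (h : 2 ≤ |u i - (j i : ℕ)|) : bump j u = 0 := by
  have hl : ∀ t, t ≤ relu t := fun t => le_max_left _ _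
  have hr : ∀ t, 0 ≤ relu t := fun t => le_max_right _ _
  refine relu_of_nonpos (sub_nonpos.2 (le_trans ?_ (Finset.single_le_sum
    (fun i _ => add_nonneg (hr _) (hr _)) (Finset.mem_univ i))))
  rcases le_abs.1 h with h | h
  · linarith [hl (u i - (j i : ℕ) - 1), hr (-u i + (j i : ℕ) - 1)]
  · linarith [hl (-u i + (j i : ℕ) - 1), hr (u i - (j i : ℕ) - 1)]

/-- A combination of cut-off functions that equals `c j` on the unit cell around each node `j` of
colour `q`. -/
def colorCoeff (q : Fin D → Fin 3) (c : (Fin D → Fin (M + 1)) → ℝ) (u : Fin D → ℝ) : ℝ :=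
  ∑ j, (if ∀ i, (j i : ℕ) % 3 = q i then c j else 0) * bump j u

theorem abs_sub_lt_of_prod_tent_ne_zero {j : Fin D → Fin (M + 1)} {u : Fin D → ℝ}
    (h : ∏ i, tent (u i - (j i : ℕ)) ≠ 0) (i : Fin D) : |u i - (j i : ℕ)| < 1 := by
  by_contra hi
  exact Finset.prod_ne_zero_iff.1 h i (Finset.mem_univ i) (tent_eq_zero (not_lt.1 hi))

theorem colorCoeff_eq {q : Fin D → Fin 3} {c : (Fin D → Fin (M + 1)) → ℝ} {u : Fin D → ℝ}
    {j : Fin D → Fin (M + 1)} (hj : ∀ i, (j i : ℕ) % 3 = q i)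
    (h : ∀ i, |u i - (j i : ℕ)| < 1) : colorCoeff q c u = c j := by
  rw [colorCoeff, Finset.sum_eq_single j, if_pos hj, bump_eq_one fun i => (h i).le, mul_one]
  · intro j' _ hne
    split_ifs with hj'
    · obtain ⟨i, hi⟩ := Function.ne_iff.1 hne
      rw [bump_eq_zero (i := i), mul_zero]
      have hi' : (j' i : ℕ) ≠ j i := fun h => hi (Fin.ext h)
      have h3 := (hj i).trans (hj' i).symm
      have hlt := abs_lt.1 (h i)
      rcases lt_or_gt_of_ne hi' with h' | h'
      · have : (j' i : ℝ) + 3 ≤ (j i : ℕ) := by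
          exact_mod_cast (show (j' i : ℕ) + 3 ≤ j i by omega)
        exact le_abs.2 (Or.inl (by linarith))
      · have : ((j i : ℕ) : ℝ) + 3 ≤ (j' i : ℕ) := by
          exact_mod_cast (show (j i : ℕ) + 3 ≤ j' i by omega)
        exact le_abs.2 (Or.inr (by linarith))
    · rw [zero_mul]
  · exact fun h => absurd (Finset.mem_univ _) h

theorem prod_colorTent_mul_clip (q : Fin D → Fin 3) {c : (Fin D → Fin (M + 1)) → ℝ}
    (hc : ∀ j, |c j| ≤ 1) (u : Fin D → ℝ) :
    (∏ i, colorTent M (q i) (u i)) * max (-1) (min 1 (colorCoeff q c u)) =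
      ∑ j : Fin D → Fin (M + 1), if (∀ i, (j i : ℕ) % 3 = q i) then
        (∏ i, tent (u i - (j i : ℕ))) * c j else 0 := by
  simp only [colorTent]
  rw [Finset.prod_univ_sum, Fintype.piFinset_univ, Finset.sum_mul]
  refine Finset.sum_congr rfl fun j _ => ?_
  rw [Finset.prod_ite_zero]
  simp only [Finset.mem_univ, true_implies]
  split_ifs with hj
  · by_cases h : ∏ i, tent (u i - (j i : ℕ)) = 0
    · rw [h, zero_mul, zero_mul]
    · have := abs_le.1 (hc j)
      rw [colorCoeff_eq hj (abs_sub_lt_of_prod_tent_ne_zero h), min_eq_right this.2,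
        max_eq_right this.1]
  · rw [zero_mul]

theorem sum_prod_colorTent_mul_clip {c : (Fin D → Fin (M + 1)) → ℝ}
    (hc : ∀ j, |c j| ≤ 1) (u : Fin D → ℝ) :
    ∑ q : Fin D → Fin 3,
      (∏ i, colorTent M (q i) (u i)) * max (-1) (min 1 (colorCoeff q c u)) =
      ∑ j : Fin D → Fin (M + 1), (∏ i, tent (u i - (j i : ℕ))) * c j := by
  simp only [prod_colorTent_mul_clip _ hc]
  rw [Finset.sum_comm]
  refine Finset.sum_congr rfl fun j _ => ?_
  rw [Finset.sum_eq_single fun i => (⟨(j i : ℕ) % 3, Nat.mod_lt _ (by norm_num)⟩ : Fin 3)]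
  · simp
  · intro q _ hq
    refine if_neg fun h => hq (funext fun i => Fin.ext (h i).symm)
  · exact fun h => absurd (Finset.mem_univ _) h

theorem sum_prod_tent (hM : 1 ≤ M) {u : Fin D → ℝ} (h : ∀ i, 0 ≤ u i ∧ u i ≤ M) :
    ∑ j : Fin D → Fin (M + 1), ∏ i, tent (u i - (j i : ℕ)) = 1 := by
  have := (Finset.prod_univ_sum (fun _ : Fin D => (Finset.univ : Finset (Fin (M + 1))))
    fun i m => tent (u i - (m : ℕ))).symm
  rw [Fintype.piFinset_univ] at this
  rw [this]
  exact Finset.prod_eq_one fun i _ => sum_tent hM (h i).1 (h i).2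

end

theorem LocallyPoly.exists_cell_coeff {D s : ℕ} {r : ℝ} (hr : 0 < r) {G : (Fin D → ℝ) → ℝ}
    {Ω : Set (Fin D → ℝ)} (hG : LocallyPoly s r G Ω) :
    ∃ C : ℝ, 0 < C ∧ ∀ N : ℕ, 1 ≤ N →
      ∃ c : (Fin D → Fin (2 * N + 1)) → (Fin s → Option (Fin D)) → ℝ, (∀ j k, |c j k| ≤ C) ∧
        ∀ z ∈ Ω, ∀ j, (∀ i, |N * (z i + 1) - (j i : ℕ)| < 1) →
          |∑ k, c j k * wordMonomial k z - G z| ≤ C * (2 / N) ^ r := by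
  obtain ⟨C, hC, hG⟩ := hG
  refine ⟨C + 1, by positivity, fun N hN => ?_⟩
  have hN' : (0 : ℝ) < N := by exact_mod_cast hN
  have : ∀ j : Fin D → Fin (2 * N + 1), ∃ c : (Fin s → Option (Fin D)) → ℝ,
      (∀ k, |c k| ≤ C + 1) ∧ ∀ z ∈ Ω, (∀ i, |N * (z i + 1) - (j i : ℕ)| < 1) →
          |∑ k, c k * wordMonomial k z - G z| ≤ (C + 1) * (2 / N) ^ r := fun j => by
    by_cases hj : ∃ w ∈ Ω, ∀ i, |N * (w i + 1) - (j i : ℕ)| < 1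
    · obtain ⟨w, hw, hwj⟩ := hj
      obtain ⟨p, ⟨c, hc, hp⟩, hGp⟩ := hG w hw
      refine ⟨c, fun k => (hc k).trans (by linarith), fun z hz hzj => ?_⟩
      rw [abs_sub_comm, ← hp]
      have hzw : ‖z - w‖ ≤ 2 / N := by
        refine (pi_norm_le_iff_of_nonneg (by positivity)).2 fun i => ?_
        have h1 := abs_lt.1 (hwj i)
        have h2 := abs_lt.1 (hzj i)
        rw [Pi.sub_apply, Real.norm_eq_abs, le_div_iff₀' hN', ← abs_of_pos hN', ← abs_mul,
          abs_le]
        constructor <;> linarith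
      exact (hGp z hz).trans (mul_le_mul (by linarith)
        (Real.rpow_le_rpow (norm_nonneg _) hzw hr.le) (by positivity) (by positivity))
    · exact ⟨fun _ => 0, fun _ => by simp; positivity, fun z hz hzj => absurd ⟨z, hz, hzj⟩ hj⟩
  choose c hc h using this
  exact ⟨c, hc, fun z hz j => h j z hz⟩

theorem abs_sum_prod_tent_sub_le {D N : ℕ} (hN : 1 ≤ N) {z : Fin D → ℝ} (hz : z ∈ cube D)
    {p : (Fin D → Fin (2 * N + 1)) → ℝ} {y ε : ℝ}
    (h : ∀ j, (∀ i, |N * (z i + 1) - (j i : ℕ)| < 1) → |p j - y| ≤ ε) :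
    |∑ j : Fin D → Fin (2 * N + 1), (∏ i, tent (N * (z i + 1) - (j i : ℕ))) * p j - y| ≤ ε := by
  have hN' : (0 : ℝ) < N := by exact_mod_cast hN
  have h1 := sum_prod_tent (M := 2 * N) (by omega) (u := fun i => N * (z i + 1)) fun i => by
    have := abs_le.1 (hz i)
    push_cast
    constructor <;> nlinarith
  have hnn : ∀ j : Fin D → Fin (2 * N + 1), 0 ≤ ∏ i, tent (N * (z i + 1) - (j i : ℕ)) :=
    fun j => Finset.prod_nonneg fun i _ => tent_nonneg _
  calc _ = |∑ j : Fin D → Fin (2 * N + 1),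
        (∏ i, tent (N * (z i + 1) - (j i : ℕ))) * (p j - y)| := by
        simp only [mul_sub, Finset.sum_sub_distrib, ← Finset.sum_mul, h1, one_mul]
    _ ≤ ∑ j : Fin D → Fin (2 * N + 1), (∏ i, tent (N * (z i + 1) - (j i : ℕ))) * ε := by
        refine (Finset.abs_sum_le_sum_abs _ _).trans (Finset.sum_le_sum fun j _ => ?_)
        rw [abs_mul, abs_of_nonneg (hnn j)]
        by_cases h0 : ∏ i, tent (N * (z i + 1) - (j i : ℕ)) = 0
        · rw [h0, zero_mul, zero_mul]
        · exact mul_le_mul_of_nonneg_left (h j (abs_sub_lt_of_prod_tent_ne_zero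
            (u := fun i => N * (z i + 1)) h0)) (hnn j)
    _ = ε := by rw [← Finset.sum_mul, h1, one_mul]

/-! ### Networks for the partition of unity -/

theorem ApproxSeq.prod_fintype {d L l : ℕ} {ι : Type} [Fintype ι]
    {f : ι → ℕ → (Fin d → ℝ) → ℝ} (hf : ∀ i, ApproxSeq d L l (f i))
    (h1 : ∀ i n, 1 ≤ n → ∀ x ∈ cube d, |f i n x| ≤ 1) :
    ApproxSeq d (L + Fintype.card ι * (2 * l + 7)) l (fun n x => ∏ i, f i n x) := by
  have := ApproxSeq.prod (fun i => hf ((Fintype.equivFin ι).symm i)) (fun i => h1 _)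
  refine (congrArg (ApproxSeq d _ l) ?_).mp this
  funext n x
  exact Equiv.prod_comp (Fintype.equivFin ι).symm fun i => f i n x

theorem colorTent_eq_sum_relu (M : ℕ) (q : Fin 3) (u : ℝ) :
    colorTent M q u = ∑ p : Fin (M + 1) × Fin 3,
      (if (p.1 : ℕ) % 3 = q then (if p.2 = 1 then -2 else 1) else 0) *
        relu (u + (1 - (p.1 : ℕ) - (p.2 : ℕ))) := by
  rw [colorTent, Fintype.sum_prod_type]
  refine Finset.sum_congr rfl fun m _ => ?_
  split_ifs with h
  · rw [Fin.sum_univ_three, tent]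
    simp only [if_true, Fin.isValue, Fin.reduceEq, if_false, Fin.coe_ofNat_eq_mod]
    norm_num
    ring_nf
  · simp

namespace NetSeq

variable {d L D : ℕ} {N : ℕ → ℕ}

theorem colorTent {F : ℕ → (Fin d → ℝ) → ℝ} (hF : NetSeq d L F) (hN1 : ∀ n, 1 ≤ N n)
    (hN : ∀ n, 1 ≤ n → N n ≤ n) (q : Fin 3) :
    NetSeq d (L + 2) (fun n x => _root_.colorTent (2 * N n) q (N n * (F n x + 1))) := by
  have hN' : ∀ n : ℕ, 1 ≤ n → (1 : ℝ) ≤ N n ∧ (N n : ℝ) ≤ n := fun n hn =>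
    ⟨by exact_mod_cast hN1 n, by exact_mod_cast hN n hn⟩
  have := shallow_one hF (Q := fun n => Fin (2 * N n + 1) × Fin 3) (fun n _ => N n)
    (fun n p => N n + (1 - (p.1 : ℕ) - (p.2 : ℕ)))
    (fun n p => if (p.1 : ℕ) % 3 = q then (if p.2 = 1 then -2 else 1) else 0)
    (fun _ => 0) 9 1 (fun n hn => ?_) (fun n hn p => ?_) (fun n hn p => ?_) (fun n hn p => ?_)
    (fun n hn => ?_)
  · refine (congrArg (NetSeq d (L + 2)) ?_).mp this
    funext n x
    rw [colorTent_eq_sum_relu, add_zero]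
    refine Finset.sum_congr rfl fun p _ => ?_
    ring_nf
  · rw [Fintype.card_prod, Fintype.card_fin, Fintype.card_fin]
    have := hN1 n
    have := hN n hn
    omega
  · obtain ⟨h1, h2⟩ := hN' n hn
    rw [abs_of_nonneg (by linarith)]
    push_cast
    linarith
  · obtain ⟨h1, h2⟩ := hN' n hn
    have h3 : ((p.1 : ℕ) : ℝ) ≤ 2 * N n := by exact_mod_cast Nat.lt_succ_iff.1 p.1.2
    have h4 : ((p.2 : ℕ) : ℝ) ≤ 2 := by exact_mod_cast Nat.lt_succ_iff.1 p.2.2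
    have h5 : (0 : ℝ) ≤ ((p.1 : ℕ) : ℝ) := Nat.cast_nonneg _
    have h6 : (0 : ℝ) ≤ ((p.2 : ℕ) : ℝ) := Nat.cast_nonneg _
    push_cast
    rw [abs_le]
    constructor <;> linarith
  · obtain ⟨h1, h2⟩ := hN' n hn
    push_cast
    split_ifs <;> norm_num <;> linarith
  · simp

theorem colorCoeff {F : Fin D → ℕ → (Fin d → ℝ) → ℝ} (hF : ∀ i, NetSeq d L (F i))
    (hN1 : ∀ n, 1 ≤ N n) (hN : ∀ n, 1 ≤ n → N n ≤ n) (hND : ∀ n, 1 ≤ n → N n ^ D ≤ n)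
    (q : Fin D → Fin 3) (c : ∀ n, (Fin D → Fin (2 * N n + 1)) → ℝ) (hc : ∀ n j, |c n j| ≤ 1) :
    NetSeq d (L + 3)
      (fun n x => _root_.colorCoeff q (c n) (fun i => N n * (F i n x + 1))) := by
  have hN' : ∀ n : ℕ, 1 ≤ n → (1 : ℝ) ≤ N n ∧ (N n : ℝ) ≤ n := fun n hn =>
    ⟨by exact_mod_cast hN1 n, by exact_mod_cast hN n hn⟩
  have hcard : ∀ n, 1 ≤ n → Fintype.card (Fin D → Fin (2 * N n + 1)) ≤ 3 ^ D * n := fun n hn => by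
    rw [Fintype.card_fun, Fintype.card_fin, Fintype.card_fin]
    calc (2 * N n + 1) ^ D ≤ (3 * N n) ^ D := Nat.pow_le_pow_left (by have := hN1 n; omega) _
      _ = 3 ^ D * N n ^ D := mul_pow _ _ _
      _ ≤ _ := Nat.mul_le_mul_left _ (hND n hn)
  set C := 3 ^ D * (2 * D + 1) + 6 * D + 2 with hC
  have hC3 : 3 ^ D ≤ C := by
    have := Nat.mul_le_mul_left (3 ^ D) (show 1 ≤ 2 * D + 1 by omega)
    omega
  have hC2 : (2 : ℝ) ≤ C := by exact_mod_cast (show 2 ≤ C by omega)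
  have hCn : ∀ n : ℕ, 1 ≤ n → 2 * (n : ℝ) ≤ C * (n : ℝ) ^ 1 := fun n _ => by
    rw [pow_one]; gcongr
  have := shallow_two hF (Q := fun n => Fin D × Fin (2 * N n + 1) × Bool)
    (Q' := fun n => Fin D → Fin (2 * N n + 1))
    (fun n p i => if i = p.1 then (if p.2.2 then (N n : ℝ) else -N n) else 0)
    (fun n p => if p.2.2 then N n - (p.2.1 : ℕ) - 1 else -N n + (p.2.1 : ℕ) - 1)
    (fun n j p => if j p.1 = p.2.1 then -1 else 0) (fun n _ => 1)
    (fun n j => if ∀ i, (j i : ℕ) % 3 = q i then c n j else 0) (C' := C) (K' := 1)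
    (fun n hn => ?_) (fun n hn => ?_) (fun n hn => ?_) (fun n hn p i => ?_) (fun n hn p => ?_)
    (fun n hn j p => ?_) (fun n hn j => ?_) (fun n hn j => ?_)
  · refine (congrArg (NetSeq d (L + 3)) ?_).mp this
    funext n x
    rw [_root_.colorCoeff]
    refine Finset.sum_congr rfl fun j _ => ?_
    rw [bump]
    congr 2
    rw [sub_eq_add_neg, add_comm]
    congr 1
    simp only [Fintype.sum_prod_type, Fintype.sum_bool, ite_mul, zero_mul, neg_mul, one_mul,
      Finset.sum_ite_eq', Finset.mem_univ, if_true, Bool.false_eq_true, if_false]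
    rw [← Finset.sum_neg_distrib]
    refine Finset.sum_congr rfl fun i _ => ?_
    rw [Finset.sum_eq_single (j i)]
    · simp only [if_true]
      ring_nf
    · intro m _ hm
      simp [hm.symm]
    · exact fun h => absurd (Finset.mem_univ _) h
  · simp only [Fintype.card_prod, Fintype.card_fin, Fintype.card_bool]
    have h1 := hN1 n
    calc D * ((2 * N n + 1) * 2) ≤ D * (6 * n) :=
          Nat.mul_le_mul_left _ (by have := hN n hn; omega)
      _ = 6 * D * n := by ring
      _ ≤ C * n := Nat.mul_le_mul_right _ (by omega)
  · exact (hcard n hn).trans (Nat.mul_le_mul_right _ hC3)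
  · have hrow : ∀ j : Fin D → Fin (2 * N n + 1),
        (∑ p : Fin D × Fin (2 * N n + 1) × Bool,
          if (if j p.1 = p.2.1 then (-1 : ℝ) else 0) = 0 then 0 else 1) = D * 2 := fun j => by
      have : ∀ a b : ℕ, ((if (if a = b then (-1 : ℝ) else 0) = 0 then 0 else 1 : ℕ)) =
          if a = b then 1 else 0 := fun a b => by split_ifs <;> simp_all
      simp only [← Fin.val_inj, this, Fintype.sum_prod_type, Fintype.sum_bool]
      simp [Fin.val_inj, Finset.sum_add_distrib, mul_two]
    calc _ = ∑ j : Fin D → Fin (2 * N n + 1), (D * 2 + 1) := by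
          rw [layerCost]
          refine Finset.sum_congr rfl fun j _ => ?_
          rw [hrow j, if_neg one_ne_zero]
      _ ≤ 3 ^ D * n * (D * 2 + 1) := by
          rw [Finset.sum_const, smul_eq_mul, Finset.card_univ]
          exact Nat.mul_le_mul_right _ (hcard n hn)
      _ = 3 ^ D * (2 * D + 1) * n := by ring
      _ ≤ C * n := Nat.mul_le_mul_right _ (by omega)
  · obtain ⟨h1, h2⟩ := hN' n hn
    refine le_trans ?_ (hCn n hn)
    split_ifs <;> simp <;> linarith
  · obtain ⟨h1, h2⟩ := hN' n hn
    have h3 : ((p.2.1 : ℕ) : ℝ) ≤ 2 * N n := by exact_mod_cast Nat.lt_succ_iff.1 p.2.1.2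
    have h5 : (0 : ℝ) ≤ ((p.2.1 : ℕ) : ℝ) := Nat.cast_nonneg _
    refine le_trans ?_ (hCn n hn)
    split_ifs <;> rw [abs_le] <;> constructor <;> linarith
  · obtain ⟨h1, h2⟩ := hN' n hn
    refine le_trans ?_ (hCn n hn)
    split_ifs
    · simp
      linarith
    · simp
  · obtain ⟨h1, h2⟩ := hN' n hn
    refine le_trans ?_ (hCn n hn)
    simp
    linarith
  · obtain ⟨h1, h2⟩ := hN' n hn
    refine le_trans ?_ (hCn n hn)
    have := hc n j
    split_ifs
    · linarith
    · simp

end NetSeq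

/-- Approximation of a locally polynomial function of network features. -/
theorem LocallyPoly.exists_netSeq {D s d L : ℕ} {r : ℝ} (hD : 0 < D) (hr : 0 < r)
    {G : (Fin D → ℝ) → ℝ} {Ω : Set (Fin D → ℝ)} (hG : LocallyPoly s r G Ω) (hΩ : Ω ⊆ cube D)
    {Z : Fin D → ℕ → (Fin d → ℝ) → ℝ} (hZ : ∀ i, NetSeq d L (Z i))
    (hZΩ : ∀ n, 1 ≤ n → ∀ x ∈ cube d, (fun i => Z i n x) ∈ Ω)
    {N : ℕ → ℕ} (hN1 : ∀ n, 1 ≤ N n) (hND : ∀ n, 1 ≤ n → N n ^ D ≤ n) (l : ℕ) :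
    ∃ F : ℕ → (Fin d → ℝ) → ℝ, NetSeq d (L + 5 + (D + 1 + s) * (2 * l + 7) + 1) F ∧
      ∃ C : ℝ, 0 ≤ C ∧ ∀ n, 1 ≤ n → ∀ x ∈ cube d,
        |F n x - G (fun i => Z i n x)| ≤
          C * (1 / ((n : ℝ) ^ 2) ^ l) + C * (2 / N n) ^ r := by
  obtain ⟨C₀, hC₀, hcell⟩ := hG.exists_cell_coeff hr
  choose c hc hcG using fun n => hcell (N n) (hN1 n)
  have hN : ∀ n, 1 ≤ n → N n ≤ n := fun n hn =>
    (Nat.le_self_pow hD.ne' _).trans (hND n hn)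
  have hc1 : ∀ k n j, |c n j k / C₀| ≤ 1 := fun k n j => by
    rw [abs_div, abs_of_pos hC₀]
    exact div_le_one_of_le₀ (hc n j k) hC₀.le
  have hZ1 : ∀ i n, 1 ≤ n → ∀ x ∈ cube d, |Z i n x| ≤ 1 := fun i n hn x hx =>
    hΩ (hZΩ n hn x hx) i
  have hterm : ∀ p : (Fin D → Fin 3) × (Fin s → Option (Fin D)),
      ApproxSeq d (L + 5 + (D + 1 + s) * (2 * l + 7)) l (fun n x =>
        (∏ i, colorTent (2 * N n) (p.1 i) (N n * (Z i n x + 1))) *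
          max (-1) (min 1 (colorCoeff p.1 (fun j => c n j p.2 / C₀)
            (fun i => N n * (Z i n x + 1)))) * wordMonomial p.2 (fun i => Z i n x)) := by
    rintro ⟨q, k⟩
    have htent := fun i => ((hZ i).colorTent hN1 hN (q i)).mono (show L + 2 ≤ L + 5 by omega)
    have hcoeff := (NetSeq.colorCoeff hZ hN1 hN hND q (fun n j => c n j k / C₀) (hc1 k)).clip
    have hword : ∀ o : Option (Fin D),
        NetSeq d (L + 5) (fun n x => o.elim 1 (fun i => Z i n x)) := fun o => by
      cases o with
      | none => exact (NetSeq.const 1).mono (Nat.zero_le _)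
      | some i => exact (hZ i).mono (by omega)
    have htent1 : ∀ i n, 1 ≤ n → ∀ x ∈ cube d,
        |colorTent (2 * N n) (q i) (N n * (Z i n x + 1))| ≤ 1 := fun i n hn x hx => by
      have h1 := abs_le.1 (hZ1 i n hn x hx)
      have h2 : (1 : ℝ) ≤ N n := by exact_mod_cast hN1 n
      refine colorTent_mem (by have := hN1 n; omega) _ ?_ ?_
      · nlinarith
      · push_cast; nlinarith
    have hword1 : ∀ o : Option (Fin D), ∀ n, 1 ≤ n → ∀ x ∈ cube d,
        |o.elim 1 (fun i => Z i n x)| ≤ 1 := fun o n hn x hx =>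
      abs_elim_le (hΩ (hZΩ n hn x hx)) o
    have := ApproxSeq.prod_fintype (ι := (Fin D ⊕ Unit) ⊕ Fin s) (l := l)
      (f := fun i n x => Sum.elim (Sum.elim
        (fun i => colorTent (2 * N n) (q i) (N n * (Z i n x + 1)))
        (fun _ => max (-1) (min 1 (colorCoeff q (fun j => c n j k / C₀)
            (fun i => N n * (Z i n x + 1))))))
        (fun j => (k j).elim 1 (fun i => Z i n x)) i)
      (L := L + 5) (fun i => ?_) (fun i => ?_)
    · simpa [Fintype.prod_sum_type, wordMonomial] using this
    · rcases i with (i | i) | j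
      · exact (htent i).approxSeq l (htent1 i)
      · exact hcoeff.approxSeq l fun n _ x _ => abs_clip_le _
      · exact (hword (k j)).approxSeq l (hword1 (k j))
    · rcases i with (i | i) | j
      · exact htent1 i
      · exact fun n _ x _ => abs_clip_le _
      · exact hword1 (k j)
  choose F hF _ C hC hFC using hterm
  refine ⟨_, NetSeq.linComb_const hF (fun _ => C₀), C₀ * ∑ p, C p + C₀,
    add_nonneg (mul_nonneg hC₀.le (Finset.sum_nonneg fun p _ => hC p)) hC₀.le,
    fun n hn x hx => ?_⟩
  have hz := hZΩ n hn x hx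
  set z : Fin D → ℝ := fun i => Z i n x with hzdef
  have hmain := abs_sum_prod_tent_sub_le (hN1 n) (hΩ hz) (fun j hj => hcG n z hz j hj)
  have hsum : ∑ j : Fin D → Fin (2 * N n + 1), (∏ i, tent (N n * (z i + 1) - (j i : ℕ))) *
      ∑ k, c n j k * wordMonomial k z =
      ∑ p : (Fin D → Fin 3) × (Fin s → Option (Fin D)), C₀ *
        ((∏ i, colorTent (2 * N n) (p.1 i) (N n * (z i + 1))) *
          max (-1) (min 1 (colorCoeff p.1 (fun j => c n j p.2 / C₀)
            (fun i => N n * (z i + 1)))) * wordMonomial p.2 z) := by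
    rw [Fintype.sum_prod_type_right]
    simp only [Finset.mul_sum]
    rw [Finset.sum_comm]
    refine Finset.sum_congr rfl fun k _ => ?_
    have := sum_prod_colorTent_mul_clip (hc1 k n) (fun i => N n * (z i + 1))
    rw [← Finset.mul_sum, ← Finset.sum_mul, this, Finset.sum_mul, Finset.mul_sum]
    refine Finset.sum_congr rfl fun j _ => ?_
    field_simp
  rw [hsum] at hmain
  have hε : 0 ≤ 1 / ((n : ℝ) ^ 2) ^ l := by positivity
  have hη : 0 ≤ (2 / (N n : ℝ)) ^ r := by positivity
  have hnet : |∑ p, C₀ * F p n x - ∑ p : (Fin D → Fin 3) × (Fin s → Option (Fin D)), C₀ *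
        ((∏ i, colorTent (2 * N n) (p.1 i) (N n * (z i + 1))) *
          max (-1) (min 1 (colorCoeff p.1 (fun j => c n j p.2 / C₀)
            (fun i => N n * (z i + 1)))) * wordMonomial p.2 z)| ≤
      C₀ * (∑ p, C p) * (1 / ((n : ℝ) ^ 2) ^ l) := by
    rw [← Finset.sum_sub_distrib, Finset.mul_sum, Finset.sum_mul]
    refine (Finset.abs_sum_le_sum_abs _ _).trans (Finset.sum_le_sum fun p _ => ?_)
    rw [← mul_sub, abs_mul, abs_of_pos hC₀, mul_assoc C₀]
    exact mul_le_mul_of_nonneg_left (hFC p n hn x hx) hC₀.le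
  have hS : 0 ≤ ∑ p, C p := Finset.sum_nonneg fun p _ => hC p
  refine (abs_sub_le _ _ _).trans ((add_le_add hnet hmain).trans ?_)
  refine add_le_add (mul_le_mul_of_nonneg_right (by linarith) hε)
    (mul_le_mul_of_nonneg_right ?_ hη)
  have := mul_nonneg hC₀.le hS
  linarith

/-! ### Networks for the features and conclusion -/

theorem NetSeq.exists_radialFeature {d d' : ℕ} (hd' : 0 < d') (hdd : d' ≤ d) (l : ℕ) :
    ∃ Z : Fin (d - d' + 1) → ℕ → (Fin d → ℝ) → ℝ, (∀ k, NetSeq d (2 * l + 10) (Z k)) ∧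
      (∀ n, 1 ≤ n → ∀ x ∈ cube d, (fun k => Z k n x) ∈ featureBox (d - d') 0 1) ∧
      ∃ C : ℝ, 0 ≤ C ∧ ∀ n, 1 ≤ n → ∀ x ∈ cube d,
        ‖(fun k => Z k n x) - radialFeature d d' x‖ ≤ C * (1 / ((n : ℝ) ^ 2) ^ l) := by
  have hsq : ∀ i : Fin d, ApproxSeq d (0 + (2 * l + 7)) l (fun _ x => x i * x i) := fun i =>
    have h1 : ∀ n, 1 ≤ n → ∀ x ∈ cube d, |(fun (_ : ℕ) (x : Fin d → ℝ) => x i) n x| ≤ 1 :=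
      fun _ _ x hx => hx i
    ((NetSeq.coord i).approxSeq l h1).mul ((NetSeq.coord i).approxSeq l h1) h1
  choose F hF _ C hC hFC using hsq
  set a : Fin d → ℝ := fun i => if (i : ℕ) < d' then 1 / d' else 0 with ha
  have ha0 : ∀ i, 0 ≤ a i := fun i => by
    simp only [ha]
    split_ifs <;> positivity
  have hmean : ∀ x : Fin d → ℝ, radialFeature d d' x 0 = ∑ i, a i * (x i * x i) := fun x => by
    have := Finset.sum_subset (Finset.range_subset_range.2 hdd)
      (f := fun i => if i < d' then 1 / (d' : ℝ) * (extendZ x i) ^ 2 else 0)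
      fun i _ hi => if_neg (by simpa using hi)
    rw [radialFeature, if_pos (Fin.val_zero _), Finset.mul_sum,
      Finset.sum_congr rfl fun i hi => (if_pos (Finset.mem_range.1 hi)).symm, this,
      Finset.sum_range]
    refine Finset.sum_congr rfl fun i _ => ?_
    simp only [ha, ite_mul, zero_mul, extendZ, i.2, dif_pos, Fin.eta, sq]
  have hnet := ((NetSeq.linComb_const hF a).clip_zero).mono
    (show 0 + (2 * l + 7) + 1 + 2 ≤ 2 * l + 10 by omega)
  have htail : ∀ k : Fin (d - d'), ∀ x : Fin d → ℝ, ∃ h : d' + (k : ℕ) < d,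
      radialFeature d d' x k.succ = x ⟨d' + k, h⟩ := fun k x => by
    have hk : d' + (k : ℕ) < d := by omega
    refine ⟨hk, ?_⟩
    rw [radialFeature, if_neg (by simp), extendZ, dif_pos (by simp; omega)]
    rfl
  refine ⟨Fin.cons (fun n x => max 0 (min 1 (∑ i, a i * F i n x)))
    (fun k _ x => radialFeature d d' x k.succ), fun k => ?_, fun n hn x hx => ?_,
    ∑ i, a i * C i, Finset.sum_nonneg fun i _ => mul_nonneg (ha0 i) (hC i),
    fun n hn x hx => ?_⟩
  · refine Fin.cases hnet (fun k => ?_) k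
    have hk : d' + (k : ℕ) < d := by omega
    refine (congrArg (NetSeq d _) ?_).mp ((NetSeq.coord ⟨d' + k, hk⟩).mono (Nat.zero_le _))
    funext n x
    obtain ⟨_, h⟩ := htail k x
    exact h.symm
  · refine mem_featureBox.2 ⟨⟨le_max_left _ _, max_le zero_le_one (min_le_left _ _)⟩,
      (mem_featureBox.1 (radialFeature_mem hd' hx)).2⟩
  · have hε : 0 ≤ ∑ i, a i * C i * (1 / ((n : ℝ) ^ 2) ^ l) :=
      Finset.sum_nonneg fun i _ => mul_nonneg (mul_nonneg (ha0 i) (hC i)) (by positivity)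
    rw [Finset.sum_mul, pi_norm_le_iff_of_nonneg hε]
    refine Fin.cases ?_ (fun k => ?_)
    · obtain ⟨h0, h1⟩ := (mem_featureBox.1 (radialFeature_mem hd' hx)).1
      have hclip : ∀ t b : ℝ, 0 ≤ b → b ≤ 1 → |max 0 (min 1 t) - b| ≤ |t - b| := fun t b h0 h1 => by
        conv_lhs => rw [← max_eq_right h0, ← min_eq_right h1]
        exact (abs_max_sub_max_le_max _ _ _ _).trans (max_le (by simp)
          ((abs_min_sub_min_le_max _ _ _ _).trans (max_le (by simp) le_rfl)))
      refine (hclip _ _ h0 h1).trans ?_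
      rw [hmean, ← Finset.sum_sub_distrib]
      refine (Finset.abs_sum_le_sum_abs _ _).trans (Finset.sum_le_sum fun i _ => ?_)
      rw [← mul_sub, abs_mul, abs_of_nonneg (ha0 i), mul_assoc]
      exact mul_le_mul_of_nonneg_left (hFC i n hn x hx) (ha0 i)
    · simpa using hε

theorem exists_floor_root {D : ℕ} (hD : 0 < D) :
    ∃ N : ℕ → ℕ, (∀ n, 1 ≤ N n) ∧ (∀ n, 1 ≤ n → N n ^ D ≤ n) ∧
      ∀ n, 1 ≤ n → 2 / (N n : ℝ) ≤ 4 * (n : ℝ) ^ (-(1 / (D : ℝ))) := by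
  refine ⟨fun n => max 1 ⌊(n : ℝ) ^ (1 / (D : ℝ))⌋₊, fun n => le_max_left _ _,
    fun n hn => ?_, fun n hn => ?_⟩
  all_goals
    have hn' : (1 : ℝ) ≤ n := by exact_mod_cast hn
    have h1 : 1 ≤ (n : ℝ) ^ (1 / (D : ℝ)) := Real.one_le_rpow hn' (by positivity)
    beta_reduce
    rw [max_eq_right (Nat.le_floor (by simpa using h1))]
  · have h2 : ((⌊(n : ℝ) ^ (1 / (D : ℝ))⌋₊ : ℕ) : ℝ) ^ D ≤ n :=
      (pow_le_pow_left₀ (by positivity) (Nat.floor_le (by positivity)) D).trans_eq (by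
        rw [← Real.rpow_natCast, ← Real.rpow_mul (by positivity), one_div,
          inv_mul_cancel₀ (by positivity), Real.rpow_one])
    exact_mod_cast h2
  · have h2 : (1 : ℝ) ≤ (⌊(n : ℝ) ^ (1 / (D : ℝ))⌋₊ : ℕ) := by
      exact_mod_cast Nat.le_floor (by simpa using h1)
    have h3 := Nat.lt_floor_add_one ((n : ℝ) ^ (1 / (D : ℝ)))
    rw [Real.rpow_neg (by positivity), ← div_eq_mul_inv,
      div_le_div_iff₀ (by positivity) (by positivity)]
    linarith

theorem one_div_sq_pow_eq_rpow (n l : ℕ) :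
    1 / ((n : ℝ) ^ 2) ^ l = (n : ℝ) ^ (-(2 * (l : ℝ))) := by
  rw [← pow_mul, Real.rpow_neg (by positivity), one_div, ← Real.rpow_natCast]
  push_cast
  rfl

theorem NetSeq.exists_approx_radial {d d' s : ℕ} (hd' : 0 < d') (hdd : d' ≤ d) {r : ℝ} (hr : 0 < r)
    {fstar : (Fin d → ℝ) → ℝ} {G : (Fin (d - d' + 1) → ℝ) → ℝ}
    (hG : LocallyPoly s r G (featureBox (d - d') 0 1))
    (hfG : ∀ x ∈ cube d, fstar x = G (radialFeature d d' x)) {l : ℕ} (hl : 1 ≤ l)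
    (hrl : r / ((d - d' + 1 : ℕ) : ℝ) ≤ 2 * l) :
    ∃ F : ℕ → (Fin d → ℝ) → ℝ,
      NetSeq d (2 * l + 10 + 5 + (d - d' + 1 + 1 + s) * (2 * l + 7) + 1) F ∧
      ∃ C : ℝ, 0 ≤ C ∧ ∀ n, 1 ≤ n → ∀ x ∈ cube d,
        |F n x - fstar x| ≤ C * (n : ℝ) ^ (-(r / ((d - d' + 1 : ℕ) : ℝ))) := by
  obtain ⟨Z, hZ, hZΩ, C₁, hC₁, hZC⟩ := NetSeq.exists_radialFeature hd' hdd l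
  have hΩ := featureBox_subset_cube (d - d') (a := 0) (b := 1) (by norm_num) le_rfl
  have hD : 0 < d - d' + 1 := Nat.succ_pos _
  obtain ⟨N, hN1, hND, hN⟩ := exists_floor_root hD
  obtain ⟨F, hF, C₂, hC₂, hFC⟩ := hG.exists_netSeq hD hr hΩ hZ hZΩ hN1 hND l
  obtain ⟨C₃, hC₃, hmod⟩ := hG.exists_modulus hr hΩ
  refine ⟨F, hF, C₂ + C₂ * 4 ^ r + C₃ * (C₁ ^ r + C₁), by positivity, fun n hn x hx => ?_⟩
  have hn' : (1 : ℝ) ≤ n := by exact_mod_cast hn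
  have hn0 : (0 : ℝ) ≤ n := by linarith
  have hD1 : (1 : ℝ) ≤ ((d - d' + 1 : ℕ) : ℝ) := by exact_mod_cast hD
  set ρ := r / ((d - d' + 1 : ℕ) : ℝ) with hρ
  set ε := 1 / ((n : ℝ) ^ 2) ^ l with hε
  have hε0 : 0 ≤ ε := by positivity
  have hε1 : ε ≤ (n : ℝ) ^ (-ρ) := by
    rw [hε, one_div_sq_pow_eq_rpow]
    exact Real.rpow_le_rpow_of_exponent_le hn' (neg_le_neg hrl)
  have hε2 : ε ^ r ≤ (n : ℝ) ^ (-ρ) := by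
    rw [hε, one_div_sq_pow_eq_rpow, ← Real.rpow_mul hn0]
    refine Real.rpow_le_rpow_of_exponent_le hn' ?_
    have h1 : ρ ≤ r := div_le_self hr.le hD1
    have h2 : (1 : ℝ) ≤ l := by exact_mod_cast hl
    nlinarith
  have hη : (2 / (N n : ℝ)) ^ r ≤ 4 ^ r * (n : ℝ) ^ (-ρ) := by
    refine (Real.rpow_le_rpow (by positivity) (hN n hn) hr.le).trans_eq ?_
    rw [Real.mul_rpow (by norm_num) (by positivity), ← Real.rpow_mul hn0, hρ]
    ring_nf
  have hδ : ‖(fun k => Z k n x) - radialFeature d d' x‖ ^ r ≤ C₁ ^ r * (n : ℝ) ^ (-ρ) := by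
    refine (Real.rpow_le_rpow (norm_nonneg _) (hZC n hn x hx) hr.le).trans ?_
    rw [Real.mul_rpow hC₁ hε0]
    exact mul_le_mul_of_nonneg_left hε2 (by positivity)
  have hδ' : ‖(fun k => Z k n x) - radialFeature d d' x‖ ≤ C₁ * (n : ℝ) ^ (-ρ) :=
    (hZC n hn x hx).trans (mul_le_mul_of_nonneg_left hε1 hC₁)
  calc |F n x - fstar x| ≤ |F n x - G (fun k => Z k n x)| +
        |G (fun k => Z k n x) - G (radialFeature d d' x)| := by
        rw [hfG x hx]; exact abs_sub_le _ _ _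
    _ ≤ (C₂ * ε + C₂ * (2 / N n) ^ r) + C₃ * (‖(fun k => Z k n x) - radialFeature d d' x‖ ^ r +
        ‖(fun k => Z k n x) - radialFeature d d' x‖) :=
        add_le_add (hFC n hn x hx) (hmod _ (hZΩ n hn x hx) _ (radialFeature_mem hd' hx))
    _ ≤ (C₂ * (n : ℝ) ^ (-ρ) + C₂ * (4 ^ r * (n : ℝ) ^ (-ρ))) +
        C₃ * (C₁ ^ r * (n : ℝ) ^ (-ρ) + C₁ * (n : ℝ) ^ (-ρ)) := by gcongr
    _ = _ := by ring

theorem depth_bound {D r τ s l : ℝ} (hD : 1 ≤ D) (hr : 0 < r) (hs : 0 ≤ s) (hτ : 0 < τ)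
    (hτ1 : τ ≤ 1) (hl : 2 * l ≤ r / D + 2) :
    (D + s + 2) * (2 * l + 7) + 10 ≤ 4 * (D + r) * (D + 2 + s) / (D * τ) + 8 * (D + s) + 20 := by
  have hD0 : 0 < D := by linarith
  have h1 : 4 * (1 + r / D) * (D + s + 2) ≤ 4 * (D + r) * (D + 2 + s) / (D * τ) := by
    rw [le_div_iff₀ (by positivity)]
    have : 4 * (1 + r / D) * (D + s + 2) * (D * τ) = 4 * (D + r) * (D + 2 + s) * τ := by
      field_simp
      ring
    rw [this]
    exact mul_le_of_le_one_right (by positivity) hτ1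
  have hρ : 0 < r / D := by positivity
  nlinarith [mul_le_mul_of_nonneg_left hl (show 0 ≤ D + s + 2 by linarith),
    mul_nonneg hρ.le (show 0 ≤ D + s + 2 by linarith)]

/-- Corollary 2 of the paper: extraction of partially radial
features.  Let `r = s + v`, `0 < v ≤ 1`, `c₀ > 0`, `1 ≤ d′ ≤ d`.  For every
partially radial `f* ∈ Lip^{(r,c₀)}` of the form
`f*(x) = g(t_{d′}, x^{(d′+1)}, …, x^{(d)})` with
`t_{d′} = (d′)^{-1/2}((x⁽¹⁾)² + ⋯ + (x^{(d′)})²)` and `g ∈ Lip^{(r,c₀)}` on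
`[-1,1]^{d-d′+1}`, there are `c₆, c₇, c₈ > 0` (depending only on `c₀, r, d, f*`) and
`γ > 0` such that for every `n ∈ ℕ` there is a deep ReLU net with
`4(d−d′+1+r)(d−d′+3+s)/((d−d′+1)τ_r) + 8(d−d′+1+s) + 20` hidden layers and at most
`c₆ n` free parameters, each bounded in absolute value by
`c₇ n^{max{1,(r+d−d′+1)γ,γr/τ_r}/(d−d′+1)}`, satisfying
`sup_{x ∈ [-1,1]^d} |f*(x) − h_{f*}(x)| ≤ c₈ n^{-r/(d−d′+1)}`. -/
theorem deep_relu_partially_radial_approx (d d' s : ℕ) (hd' : 0 < d') (hdd : d' ≤ d)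
    (v c₀ : ℝ) (hv : 0 < v) (hv1 : v ≤ 1) (hc₀ : 0 < c₀)
    (fstar : (Fin d → ℝ) → ℝ) (g : (Fin (d - d' + 1) → ℝ) → ℝ)
    (hfstar : LipSmooth d s v c₀ fstar) (hg : LipSmooth (d - d' + 1) s v c₀ g)
    (hpradial : ∀ x ∈ cube d,
      fstar x = g fun k =>
        if (k : ℕ) = 0 then
          (d' : ℝ) ^ (-(1 / 2 : ℝ)) * ∑ i ∈ Finset.range d', (extendZ x i) ^ 2
        else extendZ x (d' + (k : ℕ) - 1)) :
    ∃ γ c₆ c₇ c₈ : ℝ, 0 < γ ∧ 0 < c₆ ∧ 0 < c₇ ∧ 0 < c₈ ∧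
      ∀ n : ℕ, 0 < n →
        ∃ net : ReLUNet d,
          (net.L : ℝ) ≤
            4 * (((d : ℝ) - d' + 1) + ((s : ℝ) + v)) * (((d : ℝ) - d' + 3) + s)
                / ((((d : ℝ) - d' + 1)) * tauR s v)
              + 8 * (((d : ℝ) - d' + 1) + s) + 20 ∧
          (net.numParams : ℝ) ≤ c₆ * n ∧
          net.paramBound (c₇ * (n : ℝ) ^
            ((max 1 (max ((((s : ℝ) + v) + ((d : ℝ) - d' + 1)) * γ)
                (γ * ((s : ℝ) + v) / tauR s v))) / ((d : ℝ) - d' + 1))) ∧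
          ∀ x ∈ cube d,
            |fstar x - net.eval x| ≤
              c₈ * (n : ℝ) ^ (-(((s : ℝ) + v) / ((d : ℝ) - d' + 1))) := by
  obtain ⟨G, hG, hfG⟩ := exists_locallyPoly_radial hd' hdd hv hv1 hc₀ hfstar hg hpradial
  have hcast : (d : ℝ) - d' + 1 = ((d - d' + 1 : ℕ) : ℝ) := by push_cast [hdd]; rfl
  have hcast3 : (d : ℝ) - d' + 3 = ((d - d' + 1 : ℕ) : ℝ) + 2 := by rw [← hcast]; ring
  rw [hcast, hcast3]
  set D : ℝ := ((d - d' + 1 : ℕ) : ℝ) with hDdef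
  have hD : 1 ≤ D := by rw [hDdef]; exact_mod_cast Nat.succ_pos (d - d')
  set r : ℝ := (s : ℝ) + v
  have hr : 0 < r := by positivity
  have hτ : 0 < tauR s v ∧ tauR s v ≤ 1 := by
    unfold tauR
    split_ifs
    exacts [⟨one_pos, le_rfl⟩, ⟨hv, hv1⟩]
  have hρ : 0 < r / D := by positivity
  obtain ⟨l, hl1, hl2, hl3⟩ : ∃ l : ℕ, 1 ≤ l ∧ r / D ≤ 2 * l ∧ 2 * (l : ℝ) ≤ r / D + 2 := by
    refine ⟨⌈r / D / 2⌉₊, Nat.ceil_pos.2 (by positivity), ?_, ?_⟩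
    · linarith [Nat.le_ceil (r / D / 2)]
    · linarith [Nat.ceil_lt_add_one (show 0 ≤ r / D / 2 by positivity)]
  obtain ⟨F, ⟨C, K, hF⟩, C', hC', hFC⟩ := NetSeq.exists_approx_radial hd' hdd hr hG hfG hl1 hl2
  refine ⟨K * D / (r + D) + 1, C + 2, C + 1, C' + 1, by positivity, by positivity, by positivity,
    by positivity, fun n hn => ?_⟩
  have hn1 : (1 : ℝ) ≤ n := by exact_mod_cast hn
  set E : ℝ := max 1 (max ((r + D) * (K * D / (r + D) + 1))
    ((K * D / (r + D) + 1) * r / tauR s v)) / D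
  have hE : (K : ℝ) ≤ E := by
    rw [le_div_iff₀ (by linarith)]
    refine le_trans ?_ ((le_max_left _ _).trans (le_max_right _ _))
    rw [mul_add, mul_div_cancel₀ _ (by positivity)]
    linarith
  have hpow : (n : ℝ) ^ K ≤ (n : ℝ) ^ E := by
    rw [← Real.rpow_natCast]
    exact Real.rpow_le_rpow_of_exponent_le hn1 hE
  have hR : (C : ℝ) * (n : ℝ) ^ K ≤ (C + 1) * (n : ℝ) ^ E :=
    mul_le_mul (by linarith) hpow (by positivity) (by positivity)
  have hR1 : 1 ≤ ((C : ℝ) + 1) * (n : ℝ) ^ E :=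
    one_le_mul_of_one_le_of_one_le (by simp)
      (Real.one_le_rpow hn1 ((Nat.cast_nonneg K).trans hE))
  obtain ⟨net, hL, hP, hB, heval⟩ := HidRep.exists_net_eval hR1 ((hF n hn).mono hR le_rfl)
  refine ⟨net, ?_, ?_, hB, fun x hx => ?_⟩
  · refine le_trans (le_of_eq ?_) (depth_bound hD hr (Nat.cast_nonneg s) hτ.1 hτ.2 hl3)
    rw [hL, hDdef]
    push_cast
    ring
  · calc (net.numParams : ℝ) ≤ ((C * n + 2 : ℕ) : ℝ) := by exact_mod_cast hP
      _ ≤ (C + 2) * n := by push_cast; nlinarith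
  · rw [heval, abs_sub_comm]
    exact (hFC n hn x hx).trans (mul_le_mul_of_nonneg_right (by linarith) (by positivity))

end
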